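/- arXiv:2505.21167 — 5 statements merged into one kernel-verified Lean document; each statement's English description precedes it below -/
import Mathlib

section
/- Let N ≥ 2 be an integer, let Ψ ∈ ⋀^N h be normalized, and let Φ ∈ h∧h be a normalized eigenvector of the 2-body operator γ₂^Ψ with eigenvalue Λ and canonical form Φ = Σ_{k=1}^∞ λ_k u_k ∧ v_k. Then Λ ≤ N / (1 + ((N−2)/2)·Σ_{k=1}^∞ λ_k⁴). -/
/- Setting: `H` is the one-particle Hilbert space `h`, `F` is the fermionic Fock space over
`h` (carrying annihilation operators `an f = c(f)` satisfying the CAR, with adjoints the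
creation operators `c*(f)`, and vacuum `Ω`), and `T` is the two-particle space `h ⊗ h`
(realized by a bilinear map `tp`, with the antisymmetric tensors `h ∧ h` inside it). -/

open scoped ComplexOrder

notation "⟪" x ", " y "⟫_ℂ" => @inner ℂ _ _ x y
open ContinuousLinearMap

noncomputable section

/-- A family of annihilation operators `an f = c(f)` on a Fock space `F` satisfying the
canonical anticommutation relations `{c(f), c(g)} = 0` and `{c(f), c*(g)} = ⟪f, g⟫ • 1`. -/
def SatisfiesCAR {H F : Type*} [NormedAddCommGroup H] [InnerProductSpace ℂ H]
    [NormedAddCommGroup F] [InnerProductSpace ℂ F] [CompleteSpace F]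
    (an : H → F →L[ℂ] F) : Prop :=
  (∀ f g : H, an f ∘L an g + an g ∘L an f = 0) ∧
  (∀ f g : H, an f ∘L adjoint (an g) + adjoint (an g) ∘L an f = ⟪f, g⟫_ℂ • (1 : F →L[ℂ] F))

/-- The action of `B = ∑ₖ λₖ c_{k,↓} c_{k,↑}` (where `c_{k,↑} = an (u k)` and
`c_{k,↓} = an (v k)`) on a vector of the Fock space. -/
def applyB {H F : Type*} [NormedAddCommGroup F] [InnerProductSpace ℂ F]
    (an : H → F →L[ℂ] F) (u v : ℕ → H) (lam : ℕ → ℝ) (ψ : F) : F :=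
  ∑' k : ℕ, (lam k : ℂ) • an (v k) (an (u k) ψ)

/-- The action of `B* = ∑ₖ λₖ c*_{k,↑} c*_{k,↓}` on a vector of the Fock space. -/
def applyBd {H F : Type*} [NormedAddCommGroup F] [InnerProductSpace ℂ F] [CompleteSpace F]
    (an : H → F →L[ℂ] F) (u v : ℕ → H) (lam : ℕ → ℝ) (ψ : F) : F :=
  ∑' k : ℕ, (lam k : ℂ) • adjoint (an (u k)) (adjoint (an (v k)) ψ)

/-- `ψ` belongs to the `N`-particle sector `⋀^N h` of the Fock space, i.e. `ψ` is an
eigenvector of the number operator `𝒩 = ∑ₖ (c*_{k,↑} c_{k,↑} + c*_{k,↓} c_{k,↓})` with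
eigenvalue `N` (here the `u k` and `v k` jointly form an orthonormal basis of `h`). -/
def InSector {H F : Type*} [NormedAddCommGroup F] [InnerProductSpace ℂ F] [CompleteSpace F]
    (an : H → F →L[ℂ] F) (u v : ℕ → H) (N : ℕ) (ψ : F) : Prop :=
  ∑' k : ℕ, (adjoint (an (u k)) (an (u k) ψ) + adjoint (an (v k)) (an (v k) ψ)) = (N : ℂ) • ψ

/-- `Ω` is the (normalized) vacuum vector: it is annihilated by every `an f`. -/
def IsVacuum {H F : Type*} [NormedAddCommGroup F] [InnerProductSpace ℂ F]
    (an : H → F →L[ℂ] F) (Ω : F) : Prop :=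
  ‖Ω‖ = 1 ∧ ∀ f : H, an f Ω = 0

/-- The trial states `Ψ_M = (B*)^M Ω`. -/
def PsiM {H F : Type*} [NormedAddCommGroup F] [InnerProductSpace ℂ F] [CompleteSpace F]
    (an : H → F →L[ℂ] F) (u v : ℕ → H) (lam : ℕ → ℝ) (Ω : F) : ℕ → F
  | 0 => Ω
  | M + 1 => applyBd an u v lam (PsiM an u v lam Ω M)

/-- `tp` realizes the Hilbert space `T` as the Hilbert tensor product `h ⊗ h`: inner
products of elementary tensors multiply, and elementary tensors span a dense subspace. -/
def IsHilbertTensorProduct {H T : Type*} [NormedAddCommGroup H] [InnerProductSpace ℂ H]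
    [NormedAddCommGroup T] [InnerProductSpace ℂ T]
    (tp : H →ₗ[ℂ] H →ₗ[ℂ] T) : Prop :=
  (∀ x y z w : H, ⟪tp x y, tp z w⟫_ℂ = ⟪x, z⟫_ℂ * ⟪y, w⟫_ℂ) ∧
  (Submodule.span ℂ {t : T | ∃ x y : H, t = tp x y}).topologicalClosure = ⊤

/-- The elementary antisymmetric tensor `x ∧ y = (x ⊗ y - y ⊗ x)/√2`. -/
def wedgeVec {H T : Type*} [NormedAddCommGroup H] [InnerProductSpace ℂ H]
    [NormedAddCommGroup T] [InnerProductSpace ℂ T]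
    (tp : H →ₗ[ℂ] H →ₗ[ℂ] T) (x y : H) : T :=
  (((Real.sqrt 2 : ℝ) : ℂ))⁻¹ • (tp x y - tp y x)

/-- `Φ = ∑ₖ λₖ • (u k) ∧ (v k)` is a canonical form of `Φ ∈ h ∧ h`: the sequences
`(u k)` and `(v k)` are jointly orthonormal and jointly span `h`, `λₖ ≥ 0` and
`∑ₖ λₖ² = 1`. -/
def CanonicalWedgeForm {H T : Type*} [NormedAddCommGroup H] [InnerProductSpace ℂ H]
    [NormedAddCommGroup T] [InnerProductSpace ℂ T]
    (tp : H →ₗ[ℂ] H →ₗ[ℂ] T) (u v : ℕ → H) (lam : ℕ → ℝ) (Φ : T) : Prop :=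
  Orthonormal ℂ (Sum.elim u v) ∧
  (Submodule.span ℂ (Set.range u ∪ Set.range v)).topologicalClosure = ⊤ ∧
  (∀ k, 0 ≤ lam k) ∧ (∑' k : ℕ, lam k ^ 2) = 1 ∧
  Φ = ∑' k : ℕ, (lam k : ℂ) • wedgeVec tp (u k) (v k)

/-- `G` is the two-body operator `γ₂^Ψ` associated with the state `Ψ`, characterized by
`⟪φ₁ ⊗ φ₂, G (ψ₁ ⊗ ψ₂)⟫ = ⟪Ψ, c*(ψ₁) c*(ψ₂) c(φ₂) c(φ₁) Ψ⟫`. -/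
def IsTwoBodyOp {H F T : Type*} [NormedAddCommGroup H] [InnerProductSpace ℂ H]
    [NormedAddCommGroup F] [InnerProductSpace ℂ F] [CompleteSpace F]
    [NormedAddCommGroup T] [InnerProductSpace ℂ T]
    (tp : H →ₗ[ℂ] H →ₗ[ℂ] T) (an : H → F →L[ℂ] F) (Ψ : F) (G : T →L[ℂ] T) : Prop :=
  ∀ p q r s : H,
    ⟪tp p q, G (tp r s)⟫_ℂ = ⟪Ψ, adjoint (an r) (adjoint (an s) (an q (an p Ψ)))⟫_ℂ



set_option linter.unusedSectionVars false

section helpers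

variable {A : Type*} [Ring A] [StarRing A]

lemma aux_num_comm (c d : A) (h1 : c * d = - (d * c)) (h2 : c * star d = - (star d * c)) :
    (star d * d) * c = c * (star d * d) := by
  calc (star d * d) * c = star d * (d * c) := by noncomm_ring
    _ = star d * (-(c * d)) := by rw [h1]; simp
    _ = (-(star d * c)) * d := by noncomm_ring
    _ = c * (star d * d) := by rw [← h2]; noncomm_ring

lemma aux_idem (c : A) (h1 : c * c = 0) (h2 : c * star c = 1 - star c * c) :
    (star c * c) * (star c * c) = star c * c := by
  calc (star c * c) * (star c * c) = star c * (c * star c) * c := by noncomm_ring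
    _ = star c * c - star c * star c * (c * c) := by rw [h2]; noncomm_ring
    _ = star c * c := by rw [h1]; simp

lemma aux_num_num (c d : A) (h1 : c * d = - (d * c)) (h2 : c * star d = - (star d * c)) :
    Commute (star c * c) (star d * d) := by
  have e1 : Commute (star d * d) c := aux_num_comm c d h1 h2
  have e2 : Commute (star d * d) (star c) := by
    have := e1.star_star
    simpa using this
  exact (e2.mul_right e1).symm

lemma aux_pair (a b : A) (h1 : a * b = - (b * a)) (h2 : a * star b = - (star b * a)) :
    star (b * a) * (b * a) = (star a * a) * (star b * b) := by
  have e1 := aux_num_comm a b h1 h2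
  calc star (b * a) * (b * a) = star a * ((star b * b) * a) := by rw [star_mul]; noncomm_ring
    _ = _ := by rw [e1]; noncomm_ring

lemma aux_idem2 (a b : A) (h : Commute a b) (ha : a * a = a) (hb : b * b = b) :
    (a * b) * (a * b) = a * b := by
  calc (a * b) * (a * b) = a * (b * a) * b := by noncomm_ring
    _ = (a * a) * (b * b) := by rw [← h.eq]; noncomm_ring
    _ = a * b := by rw [ha, hb]

lemma aux_one_sub (a : A) (ha : a * a = a) : (1 - a) * (1 - a) = 1 - a := by
  calc (1 - a) * (1 - a) = 1 - a - a + a * a := by noncomm_ring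
    _ = _ := by rw [ha]; abel

lemma aux_anti2 (x a b : A) (h1 : x * a = - (a * x)) (h2 : x * b = - (b * x)) :
    Commute x (b * a) := by
  show x * (b * a) = b * a * x
  calc x * (b * a) = (x * b) * a := by noncomm_ring
    _ = -(b * (x * a)) := by rw [h2]; noncomm_ring
    _ = _ := by rw [h1]; noncomm_ring

end helpers

section ops

variable {F : Type*} [NormedAddCommGroup F] [InnerProductSpace ℂ F] [CompleteSpace F]

lemma aux_inner_star (c : F →L[ℂ] F) (x y : F) : ⟪star c x, y⟫_ℂ = ⟪x, c y⟫_ℂ := by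
  rw [ContinuousLinearMap.star_eq_adjoint, ContinuousLinearMap.adjoint_inner_left]

lemma aux_inner_star' (c : F →L[ℂ] F) (x y : F) : ⟪x, star c y⟫_ℂ = ⟪c x, y⟫_ℂ := by
  rw [ContinuousLinearMap.star_eq_adjoint, ContinuousLinearMap.adjoint_inner_right]

lemma aux_normsq (c : F →L[ℂ] F) (y : F) : (‖c y‖ ^ 2 : ℝ) = RCLike.re ⟪y, (star c * c) y⟫_ℂ := by
  rw [mul_apply_eq_comp, aux_inner_star', inner_self_eq_norm_sq]

lemma aux_contr (c : F →L[ℂ] F) (h2 : c * star c = 1 - star c * c) (y : F) :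
    ‖c y‖ ^ 2 ≤ ‖y‖ ^ 2 := by
  have h := aux_normsq (star c) y
  rw [star_star, h2, sub_apply, inner_sub_right, map_sub, ← aux_normsq,
    one_apply_eq_self, inner_self_eq_norm_sq] at h
  nlinarith [sq_nonneg ‖star c y‖]

lemma aux_cross (C D : F →L[ℂ] F) (hC : C * C = 0) (hD : D * D = 0)
    (h2 : Commute C (star D)) (Ψ : F) :
    ⟪C Ψ, D Ψ⟫_ℂ = ⟪C ((1 - star D * D) Ψ), D ((1 - star C * C) Ψ)⟫_ℂ := by
  have e : star C * D = star (C * (1 - star D * D)) * (D * (1 - star C * C)) := by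
    have h3 : star C * D = D * star C := by
      have := h2.star_star
      rw [star_star] at this
      exact this
    have h4 : star C * star C = 0 := by rw [← star_mul, hC, star_zero]
    have t1 : star D * D * star C * D = 0 := by
      calc star D * D * star C * D = star D * D * (star C * D) := by noncomm_ring
        _ = star D * (D * D) * star C := by rw [h3]; noncomm_ring
        _ = 0 := by rw [hD]; simp
    have t2 : star C * D * star C = 0 := by
      rw [h3, mul_assoc, h4, mul_zero]
    have t3 : star (C * (1 - star D * D)) = star C - star D * D * star C := by
      simp [star_mul, sub_mul, mul_assoc]
    rw [t3]
    calc star C * D = star C * D - star D * D * star C * D - (star C * D * star C) * C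
          + star D * D * (star C * D * star C) * C := by rw [t1, t2]; simp
      _ = _ := by noncomm_ring
  rw [← mul_apply_eq_comp, ← mul_apply_eq_comp, ← aux_inner_star', ← aux_inner_star',
    ← mul_apply_eq_comp, ← mul_apply_eq_comp, e]

lemma aux_core (c : ℕ ⊕ ℕ → F →L[ℂ] F) (hcc : ∀ i j, c i * c j = -(c j * c i))
    (hcs : ∀ i j, i ≠ j → c i * star (c j) = -(star (c j) * c i))
    (hc1 : ∀ i, c i * star (c i) = 1 - star (c i) * c i) (hc2 : ∀ i, c i * c i = 0)
    (Ψ : F) (hΨ : ‖Ψ‖ = 1) (N : ℕ)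
    (hs : HasSum (fun k : ℕ => (star (c (.inl k)) * c (.inl k)) Ψ
      + (star (c (.inr k)) * c (.inr k)) Ψ) ((N : ℂ) • Ψ)) :
    (∀ s : Finset ℕ, ∑ j ∈ s, ‖(c (.inr j) * c (.inl j)) Ψ‖ ^ 2 ≤ (N : ℝ) / 2) ∧
    ∀ (lam : ℕ → ℝ) (s : Finset ℕ),
      ‖∑ k ∈ s, (lam k : ℂ) • (c (.inr k) * c (.inl k)) Ψ‖ ^ 2 ≤
      ∑ k ∈ s, lam k ^ 2 * ((N : ℝ) / 2
        - ((N : ℝ) - 2) / 2 * ‖(c (.inr k) * c (.inl k)) Ψ‖ ^ 2) := by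
  set n : ℕ ⊕ ℕ → F →L[ℂ] F := fun i => star (c i) * c i with hn
  set C : ℕ → F →L[ℂ] F := fun k => c (.inr k) * c (.inl k) with hCdef
  set P : ℕ → F →L[ℂ] F := fun k => star (C k) * C k with hP
  have hPn : ∀ k, P k = n (.inl k) * n (.inr k) := fun k =>
    aux_pair _ _ (hcc _ _) (hcs _ _ (by simp))
  have hnn : ∀ i j, Commute (n i) (n j) := by
    intro i j
    by_cases h : i = j
    · subst h; exact Commute.refl _
    · exact aux_num_num _ _ (hcc _ _) (hcs _ _ h)
  have hnid : ∀ i, n i * n i = n i := fun i => aux_idem _ (hc2 i) (hc1 i)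
  have hnP : ∀ i k, Commute (n i) (P k) := by
    intro i k
    rw [hPn]
    exact (hnn _ _).mul_right (hnn _ _)
  have hPid : ∀ k, P k * P k = P k := by
    intro k
    rw [hPn]
    exact aux_idem2 _ _ (hnn _ _) (hnid _) (hnid _)
  have hPstar : ∀ k, star (P k) = P k := by
    intro k; simp [hP]
  have hCC : ∀ k, C k * C k = 0 := by
    intro k
    have := aux_anti2 (c (.inl k)) (c (.inl k)) (c (.inr k)) (hcc _ _) (hcc _ _)
    calc C k * C k = c (.inr k) * (c (.inl k) * (c (.inr k) * c (.inl k))) := by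
          simp only [hCdef]; noncomm_ring
      _ = c (.inr k) * c (.inr k) * (c (.inl k) * c (.inl k)) := by rw [this.eq]; noncomm_ring
      _ = 0 := by rw [hc2]; simp
  have hcomm' : ∀ j k, j ≠ k → Commute (C j) (star (C k)) := by
    intro j k hjk
    simp only [hCdef, star_mul]
    refine (aux_anti2 _ _ _ (hcs _ _ ?_) (hcs _ _ ?_)).mul_left
      (aux_anti2 _ _ _ (hcs _ _ ?_) (hcs _ _ ?_)) <;> simp [hjk]
  -- number bound
  have hnum : ∀ (Q : F →L[ℂ] F), star Q = Q → Q * Q = Q → (∀ i, Commute (n i) Q) →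
      ∀ s : Finset ℕ, ∑ j ∈ s, ‖C j (Q Ψ)‖ ^ 2 ≤ (N : ℝ) / 2 * ‖Q Ψ‖ ^ 2 := by
    intro Q hQ1 hQ2 hQ3 s
    have hQn : ∀ i, ‖c i (Q Ψ)‖ ^ 2 = RCLike.re ⟪Q Ψ, n i Ψ⟫_ℂ := by
      intro i
      rw [aux_normsq]
      have : ⟪Q Ψ, n i Ψ⟫_ℂ = ⟪Q Ψ, n i (Q Ψ)⟫_ℂ := by
        conv_lhs => rw [← hQ2, mul_apply_eq_comp, ← hQ1, aux_inner_star, hQ1]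
        rw [← mul_apply_eq_comp, ← mul_apply_eq_comp, (hQ3 i).eq]
      rw [this]
    have hsum : HasSum (fun k => ‖c (.inl k) (Q Ψ)‖ ^ 2 + ‖c (.inr k) (Q Ψ)‖ ^ 2)
        ((N : ℝ) * ‖Q Ψ‖ ^ 2) := by
      have h2 : ⟪Q Ψ, Ψ⟫_ℂ = ⟪Q Ψ, Q Ψ⟫_ℂ := by
        conv_lhs => rw [← hQ2, mul_apply_eq_comp, ← hQ1, aux_inner_star, hQ1]
      have h1 : HasSum (fun k => Complex.re ⟪Q Ψ, n (.inl k) Ψ + n (.inr k) Ψ⟫_ℂ)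
          (Complex.re ⟪Q Ψ, (N : ℂ) • Ψ⟫_ℂ) :=
        Complex.hasSum_re (hs.mapL (innerSL ℂ (Q Ψ)))
      have h5 : (fun k => ‖c (.inl k) (Q Ψ)‖ ^ 2 + ‖c (.inr k) (Q Ψ)‖ ^ 2) =
          (fun k => Complex.re ⟪Q Ψ, n (.inl k) Ψ + n (.inr k) Ψ⟫_ℂ) := by
        funext k
        rw [hQn, hQn, inner_add_right, Complex.add_re]
        rfl
      have h6 : (N : ℝ) * ‖Q Ψ‖ ^ 2 = Complex.re ⟪Q Ψ, (N : ℂ) • Ψ⟫_ℂ := by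
        rw [inner_smul_right, h2, inner_self_eq_norm_sq_to_K]
        simp [← Complex.ofReal_pow]
      rw [h5, h6]
      exact h1
    have h3 : ∑ j ∈ s, (‖c (.inl j) (Q Ψ)‖ ^ 2 + ‖c (.inr j) (Q Ψ)‖ ^ 2)
        ≤ (N : ℝ) * ‖Q Ψ‖ ^ 2 := sum_le_hasSum s (fun i _ => by positivity) hsum
    have h4 : ∑ j ∈ s, ‖C j (Q Ψ)‖ ^ 2 ≤
        ∑ j ∈ s, (‖c (.inl j) (Q Ψ)‖ ^ 2 + ‖c (.inr j) (Q Ψ)‖ ^ 2) / 2 := by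
      refine Finset.sum_le_sum fun j _ => ?_
      have e1 : ‖C j (Q Ψ)‖ ^ 2 ≤ ‖c (.inl j) (Q Ψ)‖ ^ 2 := aux_contr _ (hc1 (.inr j)) _
      have e2 : ‖C j (Q Ψ)‖ ^ 2 ≤ ‖c (.inr j) (Q Ψ)‖ ^ 2 := by
        have : C j = - (c (.inl j) * c (.inr j)) := hcc _ _
        rw [this, neg_apply, norm_neg]
        exact aux_contr _ (hc1 (.inl j)) _
      linarith
    rw [← Finset.sum_div] at h4
    linarith
  constructor
  · intro s
    have := hnum 1 (by simp) (by simp) (fun i => Commute.one_right _) s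
    rw [one_apply_eq_self, hΨ, one_pow, mul_one] at this
    exact this
  intro lam s
  set Q : ℕ → F →L[ℂ] F := fun k => 1 - P k with hQ
  have hQnorm : ∀ k, ‖Q k Ψ‖ ^ 2 = 1 - ‖C k Ψ‖ ^ 2 := by
    intro k
    have h1 : star (Q k) * Q k = 1 - P k := by
      simp only [hQ, star_sub, star_one, hPstar]
      exact aux_one_sub _ (hPid k)
    rw [aux_normsq, h1, sub_apply, inner_sub_right, map_sub, one_apply_eq_self,
      inner_self_eq_norm_sq, ← aux_normsq, hΨ]; norm_num
  have hQnum : ∀ k, ∑ j ∈ s, ‖C j (Q k Ψ)‖ ^ 2 ≤ (N : ℝ) / 2 * (1 - ‖C k Ψ‖ ^ 2) := by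
    intro k
    rw [← hQnorm]
    refine hnum (Q k) ?_ ?_ ?_ s
    · simp [hQ, hPstar]
    · exact aux_one_sub _ (hPid k)
    · intro i; exact (Commute.one_right _).sub_right (hnP i k)
  have hexp : ‖∑ k ∈ s, (lam k : ℂ) • (C k) Ψ‖ ^ 2 =
      ∑ j ∈ s, ∑ k ∈ s, lam j * lam k * RCLike.re ⟪C j Ψ, C k Ψ⟫_ℂ := by
    rw [← inner_self_eq_norm_sq (𝕜 := ℂ), sum_inner, map_sum]
    refine Finset.sum_congr rfl fun j _ => ?_
    rw [inner_sum, map_sum]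
    refine Finset.sum_congr rfl fun k _ => ?_
    rw [inner_smul_left, inner_smul_right]
    simp
    ring
  have hterm : ∀ j k, lam j * lam k * RCLike.re ⟪C j Ψ, C k Ψ⟫_ℂ ≤
      (if j = k then lam k ^ 2 * ‖C k Ψ‖ ^ 2 else 0) +
      (lam k ^ 2 * ‖C j (Q k Ψ)‖ ^ 2 + lam j ^ 2 * ‖C k (Q j Ψ)‖ ^ 2) / 2 := by
    intro j k
    by_cases h : j = k
    · subst h
      rw [if_pos rfl, inner_self_eq_norm_sq]
      have : 0 ≤ (lam j ^ 2 * ‖C j (Q j Ψ)‖ ^ 2 + lam j ^ 2 * ‖C j (Q j Ψ)‖ ^ 2) / 2 := by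
        positivity
      nlinarith
    · rw [if_neg h, aux_cross (C j) (C k) (hCC j) (hCC k) (hcomm' j k h)]
      have hcs' : |RCLike.re ⟪C j (Q k Ψ), C k (Q j Ψ)⟫_ℂ| ≤ ‖C j (Q k Ψ)‖ * ‖C k (Q j Ψ)‖ :=
        (RCLike.abs_re_le_norm _).trans (norm_inner_le_norm _ _)
      have h1 : lam j * lam k * RCLike.re ⟪C j (Q k Ψ), C k (Q j Ψ)⟫_ℂ ≤
          |lam j| * |lam k| * (‖C j (Q k Ψ)‖ * ‖C k (Q j Ψ)‖) := by
        refine (le_abs_self _).trans ?_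
        rw [abs_mul, abs_mul]
        gcongr
      refine h1.trans ?_
      have h2 := sq_nonneg (|lam k| * ‖C j (Q k Ψ)‖ - |lam j| * ‖C k (Q j Ψ)‖)
      rw [← sq_abs (lam k), ← sq_abs (lam j)]
      nlinarith
  rw [hexp]
  have hsym : ∑ j ∈ s, ∑ k ∈ s, lam j ^ 2 * ‖C k (Q j Ψ)‖ ^ 2 =
      ∑ j ∈ s, ∑ k ∈ s, lam k ^ 2 * ‖C j (Q k Ψ)‖ ^ 2 := Finset.sum_comm
  calc _ ≤ ∑ j ∈ s, ∑ k ∈ s, ((if j = k then lam k ^ 2 * ‖C k Ψ‖ ^ 2 else 0) +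
      (lam k ^ 2 * ‖C j (Q k Ψ)‖ ^ 2 + lam j ^ 2 * ‖C k (Q j Ψ)‖ ^ 2) / 2) :=
        Finset.sum_le_sum fun j _ => Finset.sum_le_sum fun k _ => hterm j k
    _ = ∑ k ∈ s, lam k ^ 2 * ‖C k Ψ‖ ^ 2 + ∑ j ∈ s, ∑ k ∈ s, lam j ^ 2 * ‖C k (Q j Ψ)‖ ^ 2 := by
        simp only [Finset.sum_add_distrib, ← Finset.sum_div]
        rw [hsym]
        simp
    _ ≤ ∑ k ∈ s, lam k ^ 2 * ‖C k Ψ‖ ^ 2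
        + ∑ j ∈ s, lam j ^ 2 * ((N : ℝ) / 2 * (1 - ‖C j Ψ‖ ^ 2)) := by
        gcongr with j hj
        rw [← Finset.mul_sum]
        gcongr
        exact hQnum j
    _ = _ := by
        rw [← Finset.sum_add_distrib]
        refine Finset.sum_congr rfl fun k _ => ?_
        ring

end ops

/-- **Theorem 1 (correlational bound).** If `Ψ ∈ ⋀^N h` is normalized (`N ≥ 2`) and
`Φ = ∑ₖ λₖ uₖ ∧ vₖ` is a normalized eigenvector of `γ₂^Ψ` with eigenvalue `Λ`, then
`Λ ≤ N / (1 + (N-2)/2 · ∑ₖ λₖ⁴)`. -/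
theorem correlational_bound
    {H F T : Type*} [NormedAddCommGroup H] [InnerProductSpace ℂ H] [CompleteSpace H]
    [NormedAddCommGroup F] [InnerProductSpace ℂ F] [CompleteSpace F]
    [NormedAddCommGroup T] [InnerProductSpace ℂ T] [CompleteSpace T]
    (an : H → F →L[ℂ] F) (hCAR : SatisfiesCAR an)
    (tp : H →ₗ[ℂ] H →ₗ[ℂ] T) (htp : IsHilbertTensorProduct tp)
    (u v : ℕ → H) (lam : ℕ → ℝ) (Φ : T) (hΦnorm : ‖Φ‖ = 1)
    (hΦ : CanonicalWedgeForm tp u v lam Φ)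
    (N : ℕ) (hN : 2 ≤ N)
    (Ψ : F) (hΨnorm : ‖Ψ‖ = 1) (hΨsec : InSector an u v N Ψ)
    (G : T →L[ℂ] T) (hG : IsTwoBodyOp tp an Ψ G)
    (Λ : ℝ) (hEig : G Φ = (Λ : ℂ) • Φ) :
    Λ ≤ (N : ℝ) / (1 + ((N : ℝ) - 2) / 2 * ∑' k : ℕ, lam k ^ 4) := by
  obtain ⟨hon, -, hlam0, hlam2, hΦeq⟩ := hΦ
  obtain ⟨htp, -⟩ := htp
  obtain ⟨hA1, hA2⟩ := hCAR
  have hu : ∀ j k, ⟪u j, u k⟫_ℂ = if j = k then 1 else 0 := by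
    intro j k
    simpa using orthonormal_iff_ite.1 hon (.inl j) (.inl k)
  have hv : ∀ j k, ⟪v j, v k⟫_ℂ = if j = k then 1 else 0 := by
    intro j k
    simpa using orthonormal_iff_ite.1 hon (.inr j) (.inr k)
  have huv : ∀ j k, ⟪u j, v k⟫_ℂ = 0 := by
    intro j k
    simpa using orthonormal_iff_ite.1 hon (.inl j) (.inr k)
  have hvu : ∀ j k, ⟪v j, u k⟫_ℂ = 0 := by
    intro j k
    simpa using orthonormal_iff_ite.1 hon (.inr j) (.inl k)
  set c : ℕ ⊕ ℕ → F →L[ℂ] F := fun i => an (Sum.elim u v i) with hc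
  have hcc : ∀ i j, c i * c j = -(c j * c i) := fun i j => eq_neg_of_add_eq_zero_left (hA1 _ _)
  have hcs0 : ∀ i j, c i * star (c j) + star (c j) * c i
      = ⟪Sum.elim u v i, Sum.elim u v j⟫_ℂ • (1 : F →L[ℂ] F) := fun i j => hA2 _ _
  have hcs : ∀ i j, i ≠ j → c i * star (c j) = -(star (c j) * c i) := by
    intro i j hij
    have := hcs0 i j
    rw [orthonormal_iff_ite.1 hon, if_neg hij, zero_smul] at this
    exact eq_neg_of_add_eq_zero_left this
  have hc1 : ∀ i, c i * star (c i) = 1 - star (c i) * c i := by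
    intro i
    have := hcs0 i i
    rw [orthonormal_iff_ite.1 hon, if_pos rfl, one_smul] at this
    exact eq_sub_of_add_eq this
  have hc2 : ∀ i, c i * c i = 0 := by
    intro i
    have h : c i * c i + c i * c i = 0 := hA1 _ _
    rw [← two_smul ℂ] at h
    exact (smul_eq_zero.1 h).resolve_left two_ne_zero
  have hΨ0 : Ψ ≠ 0 := by
    rintro rfl
    simp at hΨnorm
  have hs : HasSum (fun k : ℕ => (star (c (.inl k)) * c (.inl k)) Ψ
      + (star (c (.inr k)) * c (.inr k)) Ψ) ((N : ℂ) • Ψ) := by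
    have h1 : Summable (fun k : ℕ => adjoint (an (u k)) (an (u k) Ψ)
        + adjoint (an (v k)) (an (v k) Ψ)) := by
      by_contra h
      have h2 := hΨsec
      rw [InSector, tsum_eq_zero_of_not_summable h] at h2
      have : (N : ℂ) ≠ 0 := by
        have : N ≠ 0 := by omega
        exact_mod_cast this
      exact (smul_ne_zero this hΨ0) h2.symm
    have h3 := h1.hasSum
    rw [show _ = _ from hΨsec] at h3
    exact h3
  obtain ⟨hp, hcore⟩ := aux_core c hcc hcs hc1 hc2 Ψ hΨnorm N hs
  set x : ℕ → F := fun k => (c (.inr k) * c (.inl k)) Ψ with hx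
  have hlamS : Summable (fun k => lam k ^ 2) := by
    by_contra h
    rw [tsum_eq_zero_of_not_summable h] at hlam2
    exact zero_ne_one hlam2
  have hlamH : HasSum (fun k => lam k ^ 2) 1 := hlam2 ▸ hlamS.hasSum
  have hpS : Summable (fun k => ‖x k‖ ^ 2) :=
    summable_of_sum_le (fun k => by positivity) hp
  have hxS : Summable (fun k => (lam k : ℂ) • x k) := by
    refine Summable.of_norm_bounded ((hlamS.add hpS).div_const 2) fun k => ?_
    rw [norm_smul, Complex.norm_real, Real.norm_eq_abs, abs_of_nonneg (hlam0 k)]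
    nlinarith [sq_nonneg (lam k - ‖x k‖)]
  obtain ⟨χ, hχ⟩ := hxS
  set W : ℕ → T := fun k => wedgeVec tp (u k) (v k) with hW
  have hΦS : HasSum (fun k => (lam k : ℂ) • W k) Φ := by
    have h1 : Summable (fun k => (lam k : ℂ) • W k) := by
      by_contra h
      rw [tsum_eq_zero_of_not_summable h] at hΦeq
      rw [hΦeq, norm_zero] at hΦnorm
      exact zero_ne_one hΦnorm
    rw [hΦeq]
    exact h1.hasSum
  have hsq : (((Real.sqrt 2 : ℝ) : ℂ))⁻¹ * (((Real.sqrt 2 : ℝ) : ℂ))⁻¹ = 1 / 2 := by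
    rw [← mul_inv, ← Complex.ofReal_mul, Real.mul_self_sqrt (by norm_num)]
    norm_num
  have hconj : (starRingEnd ℂ) (((Real.sqrt 2 : ℝ) : ℂ))⁻¹ = (((Real.sqrt 2 : ℝ) : ℂ))⁻¹ := by
    rw [map_inv₀, Complex.conj_ofReal]
  have hWW : ∀ k j, ⟪W k, W j⟫_ℂ = if k = j then 1 else 0 := by
    intro k j
    simp only [hW, wedgeVec]
    rw [inner_smul_left, inner_smul_right, hconj, ← mul_assoc, hsq]
    simp only [inner_sub_left, inner_sub_right, htp, hu, hv, huv, hvu]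
    split_ifs <;> norm_num
  have hanti : ∀ k, an (u k) (an (v k) Ψ) = - x k := by
    intro k
    have := congrArg (fun A : F →L[ℂ] F => A Ψ) (hcc (.inl k) (.inr k))
    exact this
  have hWG : ∀ k j, ⟪W k, G (W j)⟫_ℂ = 2 * ⟪x j, x k⟫_ℂ := by
    intro k j
    have hxk : an (v k) (an (u k) Ψ) = x k := rfl
    have hxj : an (v j) (an (u j) Ψ) = x j := rfl
    have hG' : ∀ p q r s : H, ⟪tp p q, G (tp r s)⟫_ℂ = ⟪an s (an r Ψ), an q (an p Ψ)⟫_ℂ := by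
      intro p q r s
      rw [hG, ContinuousLinearMap.adjoint_inner_right, ContinuousLinearMap.adjoint_inner_right]
    simp only [hW, wedgeVec]
    rw [map_smul, inner_smul_left, inner_smul_right, hconj, ← mul_assoc, hsq, map_sub]
    simp only [inner_sub_left, inner_sub_right, hG', hxk, hxj, hanti, inner_neg_left,
      inner_neg_right]
    ring
  have hWΦ : ∀ k, ⟪W k, Φ⟫_ℂ = lam k := by
    intro k
    have h1 : HasSum (fun j => ⟪W k, (lam j : ℂ) • W j⟫_ℂ) ⟪W k, Φ⟫_ℂ :=
      hΦS.mapL (innerSL ℂ (W k))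
    have h2 : (fun j => ⟪W k, (lam j : ℂ) • W j⟫_ℂ) = fun j => if j = k then (lam k : ℂ) else 0 := by
      funext j
      rw [inner_smul_right, hWW]
      by_cases h : j = k
      · subst h; simp
      · rw [if_neg h, if_neg (Ne.symm h), mul_zero]
    rw [h2] at h1
    exact h1.unique (hasSum_ite_eq k _)
  have hχx : ∀ k, ⟪x k, χ⟫_ℂ = ((Λ / 2 * lam k : ℝ) : ℂ) := by
    intro k
    have h1 : HasSum (fun j => ⟪W k, G ((lam j : ℂ) • W j)⟫_ℂ) ⟪W k, G Φ⟫_ℂ :=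
      (hΦS.mapL G).mapL (innerSL ℂ (W k))
    rw [hEig, inner_smul_right, hWΦ] at h1
    have h2 : HasSum (fun j => ⟪x k, (lam j : ℂ) • x j⟫_ℂ) ⟪x k, χ⟫_ℂ :=
      hχ.mapL (innerSL ℂ (x k))
    have h3 := h2.mapL (Complex.conjCLE : ℂ →L[ℝ] ℂ)
    have h4 : (fun j => ⟪W k, G ((lam j : ℂ) • W j)⟫_ℂ) =
        fun j => 2 * (starRingEnd ℂ) ⟪x k, (lam j : ℂ) • x j⟫_ℂ := by
      funext j
      rw [map_smul, inner_smul_right, hWG, inner_smul_right, map_mul, inner_conj_symm,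
        Complex.conj_ofReal]
      ring
    rw [h4] at h1
    have h5 : HasSum (fun j => 2 * (starRingEnd ℂ) ⟪x k, (lam j : ℂ) • x j⟫_ℂ)
        (2 * (starRingEnd ℂ) ⟪x k, χ⟫_ℂ) := HasSum.mul_left 2 h3
    have h6 := h1.unique h5
    have h7 : (starRingEnd ℂ) ⟪x k, χ⟫_ℂ = ((Λ / 2 * lam k : ℝ) : ℂ) := by
      push_cast
      linear_combination (-1 / 2 : ℂ) * h6
    rw [← Complex.conj_conj ⟪x k, χ⟫_ℂ, h7, Complex.conj_ofReal]
  have hχn : ‖χ‖ ^ 2 = Λ / 2 := by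
    have h1 : HasSum (fun k => ⟪χ, (lam k : ℂ) • x k⟫_ℂ) ⟪χ, χ⟫_ℂ := hχ.mapL (innerSL ℂ χ)
    have h2 : (fun k => ⟪χ, (lam k : ℂ) • x k⟫_ℂ) = fun k => ((Λ / 2 * lam k ^ 2 : ℝ) : ℂ) := by
      funext k
      rw [inner_smul_right, ← inner_conj_symm, hχx, Complex.conj_ofReal]
      push_cast; ring
    rw [h2] at h1
    have h3 : HasSum (fun k => ((Λ / 2 * lam k ^ 2 : ℝ) : ℂ)) ((Λ / 2 * 1 : ℝ) : ℂ) :=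
      Complex.hasSum_ofReal.2 (hlamH.mul_left _)
    have h4 := h1.unique h3
    have h5 : ‖χ‖ ^ 2 = Λ / 2 * 1 := by
      rw [← inner_self_eq_norm_sq (𝕜 := ℂ), h4]
      exact Complex.ofReal_re _
    linarith
  have hN' : (2 : ℝ) ≤ N := by exact_mod_cast hN
  have hl1 : ∀ k, lam k ^ 2 ≤ 1 := fun k =>
    le_hasSum hlamH k (fun j _ => by positivity)
  have hl4S : Summable (fun k => lam k ^ 4) := by
    refine Summable.of_nonneg_of_le (fun k => by positivity) (fun k => ?_) hlamS
    nlinarith [hl1 k, sq_nonneg (lam k)]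
  have hS0 : 0 ≤ ∑' k, lam k ^ 4 := tsum_nonneg fun k => by positivity
  set S := ∑' k, lam k ^ 4 with hS
  have hden : 0 < 1 + ((N : ℝ) - 2) / 2 * S := by
    have : 0 ≤ ((N : ℝ) - 2) / 2 * S := mul_nonneg (by linarith) hS0
    linarith
  rw [le_div_iff₀ hden]
  have hΛ0 : 0 ≤ Λ := by nlinarith [sq_nonneg ‖χ‖]
  have hpk : ∀ k, Λ / 2 * lam k ^ 2 ≤ ‖x k‖ ^ 2 := by
    intro k
    rcases hΛ0.eq_or_lt with h0 | h0
    · rw [← h0]; simp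
    have h1 : ‖⟪x k, χ⟫_ℂ‖ ≤ ‖x k‖ * ‖χ‖ := norm_inner_le_norm _ _
    rw [hχx, Complex.norm_real, Real.norm_eq_abs] at h1
    have h2 : (Λ / 2 * lam k) ^ 2 ≤ ‖x k‖ ^ 2 * (Λ / 2) := by
      rw [← hχn, ← mul_pow, hχn, ← sq_abs]
      gcongr
    have h3 : (Λ / 2) * (Λ / 2 * lam k ^ 2) ≤ (Λ / 2) * ‖x k‖ ^ 2 := by linarith [h2]
    exact le_of_mul_le_mul_left h3 (by linarith)
  have hlim1 : Filter.Tendsto (fun s : Finset ℕ => ‖∑ k ∈ s, (lam k : ℂ) • x k‖ ^ 2)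
      Filter.atTop (nhds (‖χ‖ ^ 2)) := (Filter.Tendsto.norm hχ).pow 2
  have hlim2 : HasSum (fun k => lam k ^ 2 * ((N : ℝ) / 2)
      - ((N : ℝ) - 2) / 2 * (Λ / 2) * lam k ^ 4)
      (1 * ((N : ℝ) / 2) - ((N : ℝ) - 2) / 2 * (Λ / 2) * S) :=
    (hlamH.mul_right _).sub (hl4S.hasSum.mul_left _)
  have hfin := le_of_tendsto_of_tendsto' hlim1 hlim2 (fun s => by
    refine (hcore lam s).trans (Finset.sum_le_sum fun k _ => ?_)
    have h1 : ((N : ℝ) - 2) / 2 * (Λ / 2 * lam k ^ 2) ≤ ((N : ℝ) - 2) / 2 * ‖x k‖ ^ 2 :=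
      mul_le_mul_of_nonneg_left (hpk k) (by linarith)
    nlinarith [mul_le_mul_of_nonneg_left h1 (sq_nonneg (lam k))])
  rw [hχn] at hfin
  linarith
end
end

section
/- Let Φ ∈ h∧h be normalized with canonical form Φ = Σ_{k=1}^∞ λ_k u_k ∧ v_k and set λ_max := max_k λ_k. Then for every even natural number N with N·λ_max² ≤ 1 there exists a normalized state Ψ ∈ ⋀^N h such that ⟨Φ, γ₂^Ψ Φ⟩ ≥ N·(1 − ((N−2)/2)·Σ_{k=1}^∞ λ_k⁴ − (1/2)·(N·λ_max²)²). -/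
/- Setting: `H` is the one-particle Hilbert space `h`, `F` is the fermionic Fock space over
`h` (carrying annihilation operators `an f = c(f)` satisfying the CAR, with adjoints the
creation operators `c*(f)`, and vacuum `Ω`), and `T` is the two-particle space `h ⊗ h`
(realized by a bilinear map `tp`, with the antisymmetric tensors `h ∧ h` inside it). -/

open scoped ComplexOrder

open ContinuousLinearMap

noncomputable section

section Comb
open Finset

lemma aux_double {β : Type*} [AddCommMonoid β] (A : Finset ℕ) (j : ℕ) (f : Finset ℕ → ℕ → β) :
    ∑ S ∈ powersetCard (j+1) A, ∑ k ∈ S, f (S.erase k) k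
      = ∑ R ∈ powersetCard j A, ∑ k ∈ A \ R, f R k := by
  rw [Finset.sum_sigma', Finset.sum_sigma']
  refine Finset.sum_nbij' (fun p => ⟨p.1.erase p.2, p.2⟩) (fun p => ⟨insert p.2 p.1, p.2⟩) ?_ ?_ ?_ ?_ ?_
  · rintro ⟨S, k⟩ h
    simp only [mem_sigma, mem_powersetCard, mem_sdiff] at h ⊢
    obtain ⟨⟨h1, h2⟩, h3⟩ := h
    exact ⟨⟨(erase_subset _ _).trans h1, by rw [card_erase_of_mem h3, h2]; rfl⟩, h1 h3, by simp⟩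
  · rintro ⟨S, k⟩ h
    simp only [mem_sigma, mem_powersetCard, mem_sdiff] at h ⊢
    obtain ⟨⟨h1, h2⟩, h3, h4⟩ := h
    exact ⟨⟨insert_subset h3 h1, by rw [card_insert_of_notMem h4, h2]⟩, by simp⟩
  · rintro ⟨S, k⟩ h
    simp only [mem_sigma, mem_powersetCard] at h
    simp [insert_erase h.2]
  · rintro ⟨S, k⟩ h
    simp only [mem_sigma, mem_powersetCard, mem_sdiff] at h
    simp [erase_insert h.2.2]
  · rintro ⟨S, k⟩ h
    rfl

/-- weights -/
def wE (x : ℕ → ℝ) (A : Finset ℕ) (j : ℕ) : ℝ := ∑ S ∈ powersetCard j A, ∏ k ∈ S, x k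

lemma wE_succ (x : ℕ → ℝ) (A : Finset ℕ) (j : ℕ) :
    ((j : ℝ) + 1) * wE x A (j+1)
      = ∑ R ∈ powersetCard j A, (∏ k ∈ R, x k) * ∑ k ∈ A \ R, x k := by
  have := aux_double A j (fun R k => (∏ k ∈ R, x k) * x k)
  simp only [← Finset.mul_sum] at this
  rw [← this, wE, Finset.mul_sum]
  refine Finset.sum_congr rfl fun S hS => ?_
  rw [Finset.sum_congr rfl (fun k hk => Finset.prod_erase_mul S x hk), Finset.sum_const,
    (mem_powersetCard.1 hS).2, nsmul_eq_mul]
  push_cast; ring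

lemma wE_nonneg (x : ℕ → ℝ) (hx : ∀ k, 0 ≤ x k) (A : Finset ℕ) (j : ℕ) : 0 ≤ wE x A j :=
  Finset.sum_nonneg fun _ _ => Finset.prod_nonneg fun k _ => hx k

lemma wE_lower1 (x : ℕ → ℝ) (hx : ∀ k, 0 ≤ x k) (m : ℝ) (hm : ∀ k, x k ≤ m)
    (A : Finset ℕ) (j : ℕ) :
    wE x A j * ((∑ k ∈ A, x k) - j * m) ≤ ((j : ℝ) + 1) * wE x A (j+1) := by
  rw [wE_succ, wE, Finset.sum_mul]
  refine Finset.sum_le_sum fun R hR => ?_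
  refine mul_le_mul_of_nonneg_left ?_ (Finset.prod_nonneg fun k _ => hx k)
  obtain ⟨h1, h2⟩ := mem_powersetCard.1 hR
  have := Finset.sum_sdiff h1 (f := x)
  have h3 : ∑ k ∈ R, x k ≤ j * m := by
    calc _ ≤ ∑ k ∈ R, m := Finset.sum_le_sum fun k _ => hm k
      _ = _ := by simp [h2]
  linarith

lemma wE_lower2 (x : ℕ → ℝ) (hx : ∀ k, 0 ≤ x k) (p : ℝ)
    (A : Finset ℕ) (hp : ∑ k ∈ A, x k ^ 2 ≤ p) (j : ℕ) :
    (∑ k ∈ A, x k) * wE x A (j+1) - p * wE x A j ≤ ((j : ℝ) + 2) * wE x A (j+2) := by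
  have h := wE_succ x A (j+1)
  have e : ((j : ℝ) + 2) * wE x A (j+2) = (∑ k ∈ A, x k) * wE x A (j+1)
      - ∑ R ∈ powersetCard (j+1) A, (∏ k ∈ R, x k) * ∑ k ∈ R, x k := by
    have : ((j : ℝ) + 2) = (((j+1 : ℕ) : ℝ) + 1) := by push_cast; ring
    rw [this, h, wE, Finset.mul_sum, ← Finset.sum_sub_distrib]
    refine Finset.sum_congr rfl fun R hR => ?_
    have := Finset.sum_sdiff (mem_powersetCard.1 hR).1 (f := x)
    rw [← this]; ring
  rw [e]
  have h2 := aux_double A j (fun R k => (∏ k ∈ R, x k) * (x k)^2)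
  have h3 : ∑ R ∈ powersetCard (j+1) A, (∏ k ∈ R, x k) * ∑ k ∈ R, x k
      = ∑ R ∈ powersetCard j A, ∑ k ∈ A \ R, (∏ k ∈ R, x k) * (x k)^2 := by
    rw [← h2]
    refine Finset.sum_congr rfl fun R hR => ?_
    rw [Finset.mul_sum]
    refine Finset.sum_congr rfl fun k hk => ?_
    rw [← Finset.prod_erase_mul R x hk]; ring
  rw [h3]
  have : ∑ R ∈ powersetCard j A, ∑ k ∈ A \ R, (∏ k ∈ R, x k) * (x k)^2 ≤ p * wE x A j := by
    rw [wE, Finset.mul_sum]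
    refine Finset.sum_le_sum fun R hR => ?_
    rw [← Finset.mul_sum, mul_comm p]
    refine mul_le_mul_of_nonneg_left ?_ (Finset.prod_nonneg fun k _ => hx k)
    exact (Finset.sum_le_sum_of_subset_of_nonneg sdiff_subset fun _ _ _ => sq_nonneg _).trans hp
  linarith

lemma wE_pos (x : ℕ → ℝ) (hx : ∀ k, 0 ≤ x k) (m : ℝ) (hm : ∀ k, x k ≤ m) (hm0 : 0 < m)
    (A : Finset ℕ) (hs : 1 - m^2 ≤ ∑ k ∈ A, x k) (M : ℕ) (hM : 2 * (M : ℝ) * m ≤ 1)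
    (j : ℕ) (hj : j ≤ M) : 0 < wE x A j := by
  induction j with
  | zero => simp [wE]
  | succ i ih =>
    have h1 := ih (by omega)
    have h2 := wE_lower1 x hx m hm A i
    have hi : (i : ℝ) + 1 ≤ M := by exact_mod_cast hj
    have : ((i : ℝ) + 1) * m ≤ M * m := mul_le_mul_of_nonneg_right hi hm0.le
    have hi0 : (0 : ℝ) ≤ i := by positivity
    have hm1 : m ≤ 1 := by nlinarith
    have h3 : 0 < (∑ k ∈ A, x k) - i * m := by nlinarith
    have h4 := mul_pos h1 h3
    by_contra hcon
    push Not at hcon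
    nlinarith

lemma wE_main (x : ℕ → ℝ) (hx : ∀ k, 0 ≤ x k) (m : ℝ) (hm : ∀ k, x k ≤ m) (hm0 : 0 < m)
    (A : Finset ℕ) (hs : 1 - m^2 ≤ ∑ k ∈ A, x k) (j : ℕ) (hM : 2 * ((j : ℝ) + 1) * m ≤ 1)
    (p : ℝ) (hp : ∑ k ∈ A, x k ^ 2 ≤ p) (hpm : p ≤ m) :
    (1 - j * p - 2 * ((j + 1) * m)^2) * wE x A j ≤ (j + 1) * wE x A (j+1) := by
  have hp0 : 0 ≤ p := (Finset.sum_nonneg fun _ _ => sq_nonneg _).trans hp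
  cases j with
  | zero =>
    have := wE_lower1 x hx m hm A 0
    have h0 : wE x A 0 = 1 := by simp [wE]
    rw [h0] at this ⊢
    simp at this ⊢
    nlinarith
  | succ i =>
    have h1 := wE_lower1 x hx m hm A i
    have h2 := wE_lower2 x hx p A hp i
    have h3 := wE_nonneg x hx A i
    have h4 := wE_nonneg x hx A (i+1)
    push_cast at *
    have hi0 : (0 : ℝ) ≤ i := by positivity
    have him : 0 ≤ (i : ℝ) * m := by positivity
    have hm1 : m ≤ 1 := by nlinarith
    set s := ∑ k ∈ A, x k
    set a := wE x A i
    set b := wE x A (i+1)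
    set t : ℝ := ((i : ℝ)+1) * m with ht
    have ht0 : 0 ≤ t := by positivity
    have ht2 : t ≤ 1/2 := by nlinarith
    have h5 : 1 - t ≤ s - i * m := by nlinarith
    have h6 : a * (1 - t) ≤ (i+1) * b := (mul_le_mul_of_nonneg_left h5 h3).trans h1
    have h7 : a ≤ (i+1) * b * (1 + 2 * t) := by
      have : a * (1-t) * (1+2*t) ≤ (i+1) * b * (1 + 2 * t) :=
        mul_le_mul_of_nonneg_right h6 (by positivity)
      nlinarith [mul_nonneg h3 (mul_nonneg ht0 (by linarith : 0 ≤ 1 - 2*t))]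
    have h8 : p * a ≤ ((i+1) * p + 2 * t^2) * b := by
      have e1 := mul_le_mul_of_nonneg_left h7 hp0
      have e2 : p * ((i+1) * t) ≤ m * ((i+1)*t) := mul_le_mul_of_nonneg_right hpm (by positivity)
      have e3 := mul_le_mul_of_nonneg_right e2 h4
      nlinarith
    have h9 : (1 - m^2) * b ≤ s * b := mul_le_mul_of_nonneg_right hs h4
    have h10 : 1 - (i+1) * p - 2 * ((i+1+1) * m)^2 ≤ 1 - m^2 - ((i+1)*p + 2*t^2) := by
      rw [ht]; nlinarith [mul_nonneg hi0 (sq_nonneg m), sq_nonneg m]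
    have h11 := mul_le_mul_of_nonneg_right h10 h4
    have e : ((i:ℝ)+1+1) = i + 2 := by ring
    calc _ ≤ _ := h11
      _ ≤ s * b - p * a := by linarith
      _ ≤ _ := by rw [e]; exact h2
end Comb

section Fock
open Finset
variable {H F : Type*} [NormedAddCommGroup H] [InnerProductSpace ℂ H]
    [NormedAddCommGroup F] [InnerProductSpace ℂ F] [CompleteSpace F]

lemma car1 {an : H → F →L[ℂ] F} (h : SatisfiesCAR an) (f g : H) (x : F) :
    an f (an g x) = - an g (an f x) := by
  have := DFunLike.congr_fun (h.1 f g) x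
  simp at this
  exact eq_neg_of_add_eq_zero_left this

lemma car1' {an : H → F →L[ℂ] F} (h : SatisfiesCAR an) (f g : H) (x : F) :
    adjoint (an f) (adjoint (an g) x) = - adjoint (an g) (adjoint (an f) x) := by
  refine ext_inner_left ℂ fun y => ?_
  simp only [inner_neg_right, adjoint_inner_right]
  rw [car1 h]; simp

lemma car2 {an : H → F →L[ℂ] F} (h : SatisfiesCAR an) (f g : H) (x : F) :
    an f (adjoint (an g) x) = ⟪f, g⟫_ℂ • x - adjoint (an g) (an f x) := by
  have := DFunLike.congr_fun (h.2 f g) x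
  simp at this
  exact eq_sub_of_add_eq this

/-- pair creation -/
def bd (an : H → F →L[ℂ] F) (u v : ℕ → H) (k : ℕ) : F →L[ℂ] F :=
  adjoint (an (u k)) * adjoint (an (v k))

lemma bd_apply (an : H → F →L[ℂ] F) (u v : ℕ → H) (k : ℕ) (x : F) :
    bd an u v k x = adjoint (an (u k)) (adjoint (an (v k)) x) := rfl

lemma bd_comm {an : H → F →L[ℂ] F} (h : SatisfiesCAR an) (u v : ℕ → H) (k l : ℕ) :
    Commute (bd an u v k) (bd an u v l) := by
  ext x
  simp only [mul_apply_eq_comp, bd_apply]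
  rw [car1' h (v k) (u l), map_neg, car1' h (v k) (v l), map_neg, map_neg, neg_neg,
    car1' h (u k) (u l), car1' h (u k) (v l), map_neg, neg_neg]

/-- basis -/
def eS {an : H → F →L[ℂ] F} (h : SatisfiesCAR an) (u v : ℕ → H) (Ω : F) (S : Finset ℕ) : F :=
  (S.noncommProd (bd an u v) fun k _ l _ _ => bd_comm h u v k l) Ω

variable {an : H → F →L[ℂ] F} (h : SatisfiesCAR an) {u v : ℕ → H} (Ω : F)

lemma eS_empty : eS h u v Ω ∅ = Ω := by
  have := Finset.noncommProd_empty (bd an u v) (fun k _ l _ _ => bd_comm h u v k l)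
  exact congrArg (fun L : F →L[ℂ] F => L Ω) this

lemma eS_insert {k : ℕ} {S : Finset ℕ} (hk : k ∉ S) :
    eS h u v Ω (insert k S) = bd an u v k (eS h u v Ω S) := by
  have := Finset.noncommProd_insert_of_notMem S k (bd an u v)
    (fun k _ l _ _ => bd_comm h u v k l) hk
  exact congrArg (fun L : F →L[ℂ] F => L Ω) this

lemma an_eS (hΩ : IsVacuum an Ω) (f : H) (S : Finset ℕ)
    (hf : ∀ k ∈ S, ⟪f, u k⟫_ℂ = 0 ∧ ⟪f, v k⟫_ℂ = 0) : an f (eS h u v Ω S) = 0 := by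
  induction S using Finset.induction_on with
  | empty => rw [eS_empty]; exact hΩ.2 f
  | insert k S hk ih =>
    obtain ⟨h1, h2⟩ := hf k (by simp)
    rw [eS_insert h Ω hk, bd_apply, car2 h, car2 h, h1, h2, ih fun k hk => hf k (by simp [hk])]
    simp

variable (ho : Orthonormal ℂ (Sum.elim u v)) (hΩ : IsVacuum an Ω)

include ho in
lemma o_uu (k l : ℕ) : ⟪u k, u l⟫_ℂ = if k = l then 1 else 0 := by
  have := (orthonormal_iff_ite.1 ho) (Sum.inl k) (Sum.inl l); simpa using this
include ho in
lemma o_vv (k l : ℕ) : ⟪v k, v l⟫_ℂ = if k = l then 1 else 0 := by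
  have := (orthonormal_iff_ite.1 ho) (Sum.inr k) (Sum.inr l); simpa using this
include ho in
lemma o_uv (k l : ℕ) : ⟪u k, v l⟫_ℂ = 0 := by
  have := (orthonormal_iff_ite.1 ho) (Sum.inl k) (Sum.inr l); simpa using this
include ho in
lemma o_vu (k l : ℕ) : ⟪v k, u l⟫_ℂ = 0 := by
  have := (orthonormal_iff_ite.1 ho) (Sum.inr k) (Sum.inl l); simpa using this

include ho hΩ in
lemma anu_notMem {k : ℕ} {S : Finset ℕ} (hk : k ∉ S) : an (u k) (eS h u v Ω S) = 0 := by
  refine an_eS h Ω hΩ _ _ fun l hl => ⟨?_, o_uv ho _ _⟩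
  rw [o_uu ho, if_neg]; rintro rfl; exact hk hl

include ho hΩ in
lemma anv_notMem {k : ℕ} {S : Finset ℕ} (hk : k ∉ S) : an (v k) (eS h u v Ω S) = 0 := by
  refine an_eS h Ω hΩ _ _ fun l hl => ⟨o_vu ho _ _, ?_⟩
  rw [o_vv ho, if_neg]; rintro rfl; exact hk hl

include ho hΩ in
lemma anu_mem {k : ℕ} {S : Finset ℕ} (hk : k ∈ S) :
    an (u k) (eS h u v Ω S) = adjoint (an (v k)) (eS h u v Ω (S.erase k)) := by
  conv_lhs => rw [← insert_erase hk]
  rw [eS_insert h Ω (by simp), bd_apply, car2 h, car2 h, anu_notMem h Ω ho hΩ (by simp),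
    o_uu ho, o_uv ho]
  simp

include ho hΩ in
lemma anv_mem {k : ℕ} {S : Finset ℕ} (hk : k ∈ S) :
    an (v k) (eS h u v Ω S) = - adjoint (an (u k)) (eS h u v Ω (S.erase k)) := by
  conv_lhs => rw [← insert_erase hk]
  rw [eS_insert h Ω (by simp), bd_apply, car2 h, car2 h, anv_notMem h Ω ho hΩ (by simp),
    o_vu ho, o_vv ho]
  simp

include ho hΩ in
lemma b_eS (k : ℕ) (S : Finset ℕ) :
    an (v k) (an (u k) (eS h u v Ω S)) = if k ∈ S then eS h u v Ω (S.erase k) else 0 := by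
  split_ifs with hk
  · rw [anu_mem h Ω ho hΩ hk, car2 h, anv_notMem h Ω ho hΩ (by simp), o_vv ho]; simp
  · rw [anu_notMem h Ω ho hΩ hk]; simp

include ho hΩ in
lemma n_eS (k : ℕ) (S : Finset ℕ) :
    adjoint (an (u k)) (an (u k) (eS h u v Ω S)) + adjoint (an (v k)) (an (v k) (eS h u v Ω S))
      = if k ∈ S then (2 : ℂ) • eS h u v Ω S else 0 := by
  split_ifs with hk
  · rw [anu_mem h Ω ho hΩ hk, anv_mem h Ω ho hΩ hk, map_neg, ← car1' h, ← bd_apply,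
      ← eS_insert h Ω (by simp), insert_erase hk, two_smul]
  · rw [anu_notMem h Ω ho hΩ hk, anv_notMem h Ω ho hΩ hk]; simp

include ho hΩ in
lemma inner_eS (S R : Finset ℕ) :
    ⟪eS h u v Ω S, eS h u v Ω R⟫_ℂ = if S = R then 1 else 0 := by
  induction S using Finset.induction_on generalizing R with
  | empty =>
    split_ifs with hR
    · subst hR
      rw [eS_empty, inner_self_eq_norm_sq_to_K, hΩ.1]; simp
    · obtain ⟨k, hk⟩ := Finset.nonempty_iff_ne_empty.2 (Ne.symm hR)
      rw [← insert_erase hk, eS_insert h Ω (by simp), bd_apply, adjoint_inner_right, eS_empty,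
        hΩ.2, inner_zero_left]
  | insert k S hk ih =>
    rw [eS_insert h Ω hk, bd_apply, adjoint_inner_left, adjoint_inner_left, b_eS h Ω ho hΩ]
    by_cases hR : k ∈ R
    · rw [if_pos hR, ih]
      congr 1
      refine propext ⟨?_, ?_⟩
      · rintro rfl; exact insert_erase hR
      · rintro rfl; exact (erase_insert hk).symm
    · rw [if_neg hR, inner_zero_right, if_neg]
      rintro rfl; simp at hR

include ho hΩ in
lemma orth_eS : Orthonormal ℂ (eS h u v Ω) :=
  orthonormal_iff_ite.2 fun S R => by rw [inner_eS h Ω ho hΩ]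

/-- trial state -/
def psi0 (lam : ℕ → ℝ) (A : Finset ℕ) (M : ℕ) : F :=
  ∑ S ∈ powersetCard M A, ((∏ k ∈ S, lam k : ℝ) : ℂ) • eS h u v Ω S

include ho hΩ in
lemma b_psi0 (lam : ℕ → ℝ) (A : Finset ℕ) (M k : ℕ) :
    an (v k) (an (u k) (psi0 h (u := u) (v := v) Ω lam A M)) =
      ∑ S ∈ powersetCard M A, if k ∈ S then
        ((∏ k ∈ S, lam k : ℝ) : ℂ) • eS h u v Ω (S.erase k) else 0 := by
  simp only [psi0, map_sum, map_smul, b_eS h Ω ho hΩ, smul_ite, smul_zero]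

include ho hΩ in
lemma b_psi0_notMem (lam : ℕ → ℝ) (A : Finset ℕ) (M k : ℕ) (hk : k ∉ A) :
    an (v k) (an (u k) (psi0 h (u := u) (v := v) Ω lam A M)) = 0 := by
  rw [b_psi0 h Ω ho hΩ]
  refine Finset.sum_eq_zero fun S hS => if_neg fun hh => hk ((mem_powersetCard.1 hS).1 hh)

include ho hΩ in
lemma B_psi0 (lam : ℕ → ℝ) (A : Finset ℕ) (j : ℕ) :
    ∑ k ∈ A, (lam k : ℂ) • an (v k) (an (u k) (psi0 h (u := u) (v := v) Ω lam A (j+1))) =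
      ∑ R ∈ powersetCard j A,
        (((∏ k ∈ R, lam k) * ∑ k ∈ A \ R, lam k ^ 2 : ℝ) : ℂ) • eS h u v Ω R := by
  have := aux_double A j
    (fun R k => (((∏ k ∈ R, lam k) * lam k ^ 2 : ℝ) : ℂ) • eS h u v Ω R)
  simp only [← Finset.sum_smul, ← Complex.ofReal_sum, ← Finset.mul_sum] at this
  rw [← this]
  simp only [b_psi0 h Ω ho hΩ, Finset.smul_sum]
  rw [Finset.sum_comm]
  refine Finset.sum_congr rfl fun S hS => ?_
  simp only [smul_ite, smul_zero]
  rw [← Finset.sum_filter, Finset.filter_mem_eq_inter,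
    Finset.inter_eq_right.2 (mem_powersetCard.1 hS).1]
  refine Finset.sum_congr rfl fun k hk => ?_
  rw [smul_smul, ← Finset.prod_erase_mul S lam hk]
  congr 1
  push_cast; ring

include ho hΩ in
lemma norm_sum_eS (c : Finset ℕ → ℝ) (s : Finset (Finset ℕ)) :
    ‖∑ S ∈ s, (c S : ℂ) • eS h u v Ω S‖ ^ 2 = ∑ S ∈ s, c S ^ 2 := by
  have := (orth_eS h Ω ho hΩ).inner_sum (fun S => (c S : ℂ)) (fun S => (c S : ℂ)) s
  rw [inner_self_eq_norm_sq_to_K] at this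
  have h2 : ((‖∑ S ∈ s, (c S : ℂ) • eS h u v Ω S‖ ^ 2 : ℝ) : ℂ)
      = ((∑ S ∈ s, c S ^ 2 : ℝ) : ℂ) := by
    push_cast
    simp only [Complex.coe_algebraMap] at this
    rw [this]
    refine Finset.sum_congr rfl fun S _ => ?_
    rw [Complex.conj_ofReal]; ring
  exact_mod_cast h2

include ho hΩ in
lemma sector_psi0 (lam : ℕ → ℝ) (A : Finset ℕ) (M : ℕ) :
    InSector an u v (2*M) (psi0 h (u := u) (v := v) Ω lam A M) := by
  have key : ∀ k, adjoint (an (u k)) (an (u k) (psi0 h (u := u) (v := v) Ω lam A M))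
      + adjoint (an (v k)) (an (v k) (psi0 h (u := u) (v := v) Ω lam A M))
      = ∑ S ∈ powersetCard M A, if k ∈ S then
        (2 : ℂ) • ((∏ k ∈ S, lam k : ℝ) : ℂ) • eS h u v Ω S else 0 := by
    intro k
    simp only [psi0, map_sum, map_smul, ← Finset.sum_add_distrib, ← smul_add, n_eS h Ω ho hΩ,
      smul_ite, smul_zero]
    refine Finset.sum_congr rfl fun S _ => ?_
    rw [smul_comm]
  unfold InSector
  simp only [key]
  rw [tsum_eq_sum (s := A)]
  · rw [Finset.sum_comm, psi0, Finset.smul_sum]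
    refine Finset.sum_congr rfl fun S hS => ?_
    rw [← Finset.sum_filter, Finset.filter_mem_eq_inter,
      Finset.inter_eq_right.2 (mem_powersetCard.1 hS).1, Finset.sum_const,
      (mem_powersetCard.1 hS).2, ← Nat.cast_smul_eq_nsmul ℂ, smul_smul]
    congr 1
    push_cast; ring
  · intro k hk
    refine Finset.sum_eq_zero fun S hS => if_neg fun hh => hk ((mem_powersetCard.1 hS).1 hh)

variable {T : Type*} [NormedAddCommGroup T] [InnerProductSpace ℂ T]

include h in
lemma wedge_G (tp : H →ₗ[ℂ] H →ₗ[ℂ] T) (Ψ : F) (G : T →L[ℂ] T) (hG : IsTwoBodyOp tp an Ψ G)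
    (p q r s : H) :
    ⟪wedgeVec tp p q, G (wedgeVec tp r s)⟫_ℂ = 2 * ⟪an s (an r Ψ), an q (an p Ψ)⟫_ℂ := by
  have hG' : ∀ p q r s : H,
    ⟪tp p q, G (tp r s)⟫_ℂ = ⟪an s (an r Ψ), an q (an p Ψ)⟫_ℂ := by
    intro p q r s
    rw [hG, adjoint_inner_right, adjoint_inner_right]
  have h2 : ((Real.sqrt 2 : ℝ) : ℂ)⁻¹ * ((Real.sqrt 2 : ℝ) : ℂ)⁻¹ = 2⁻¹ := by
    rw [← mul_inv, ← Complex.ofReal_mul, Real.mul_self_sqrt (by norm_num)]; norm_num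
  simp only [wedgeVec, map_smul, inner_smul_left, inner_smul_right, map_sub, inner_sub_left,
    inner_sub_right, hG', map_inv₀, Complex.conj_ofReal]
  rw [car1 h r s, car1 h p q, inner_neg_left, inner_neg_right, inner_neg_right, inner_neg_left]
  linear_combination (4 * ⟪an s (an r Ψ), an q (an p Ψ)⟫_ℂ) * h2

include h in
lemma Phi_G (tp : H →ₗ[ℂ] H →ₗ[ℂ] T) (Ψ : F) (G : T →L[ℂ] T) (hG : IsTwoBodyOp tp an Ψ G)
    (lam : ℕ → ℝ) (Φ : T)
    (hΦ : HasSum (fun k => (lam k : ℂ) • wedgeVec tp (u k) (v k)) Φ)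
    (A : Finset ℕ) (hA : ∀ k, k ∉ A → an (v k) (an (u k) Ψ) = 0) :
    ⟪Φ, G Φ⟫_ℂ = ((2 * ‖∑ k ∈ A, (lam k : ℂ) • an (v k) (an (u k) Ψ)‖ ^ 2 : ℝ) : ℂ) := by
  set BΨ := ∑ k ∈ A, (lam k : ℂ) • an (v k) (an (u k) Ψ) with hB
  have h1 : ∀ k, ⟪wedgeVec tp (u k) (v k), G Φ⟫_ℂ = 2 * ⟪BΨ, an (v k) (an (u k) Ψ)⟫_ℂ := by
    intro k
    have e1 := (hΦ.mapL G).mapL (innerSL ℂ (wedgeVec tp (u k) (v k)))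
    have e2 : ∀ l, l ∉ A → innerSL ℂ (wedgeVec tp (u k) (v k))
        (G ((lam l : ℂ) • wedgeVec tp (u l) (v l))) = 0 := by
      intro l hl
      simp only [innerSL_apply_apply, map_smul, inner_smul_right, wedge_G h tp Ψ G hG, hA l hl]
      simp
    have e3 := e1.unique (hasSum_sum_of_ne_finset_zero e2)
    rw [innerSL_apply_apply] at e3
    rw [e3, hB, sum_inner, Finset.mul_sum]
    refine Finset.sum_congr rfl fun l _ => ?_
    simp only [innerSL_apply_apply, map_smul, inner_smul_right, inner_smul_left,
      wedge_G h tp Ψ G hG, smul_eq_mul, Complex.conj_ofReal]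
    ring
  have e1 := hΦ.mapL (innerSL ℂ (G Φ))
  have e2 : ∀ l, l ∉ A → innerSL ℂ (G Φ) ((lam l : ℂ) • wedgeVec tp (u l) (v l)) = 0 := by
    intro l hl
    simp only [innerSL_apply_apply, inner_smul_right]
    rw [← inner_conj_symm, h1, hA l hl]; simp
  have e3 := e1.unique (hasSum_sum_of_ne_finset_zero e2)
  rw [innerSL_apply_apply] at e3
  have e4 : ⟪G Φ, Φ⟫_ℂ = 2 * ⟪BΨ, BΨ⟫_ℂ := by
    rw [e3]
    conv_rhs => rw [hB, sum_inner, Finset.mul_sum]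
    refine Finset.sum_congr rfl fun l _ => ?_
    simp only [innerSL_apply_apply, inner_smul_right, inner_smul_left, Complex.conj_ofReal]
    rw [← inner_conj_symm, h1, map_mul, inner_conj_symm, hB]
    rw [Complex.conj_ofNat]; ring
  rw [← inner_conj_symm, e4, map_mul, inner_conj_symm, inner_self_eq_norm_sq_to_K,
    Complex.conj_ofNat]
  simp
end Fock

/-- **Theorem 2 (lower bound).** For normalized `Φ = ∑ₖ λₖ uₖ ∧ vₖ` and every even `N`
with `N·λ_max² ≤ 1` there is a normalized `Ψ ∈ ⋀^N h` with
`⟪Φ, γ₂^Ψ Φ⟫ ≥ N·(1 - (N-2)/2·∑ₖ λₖ⁴ - (1/2)·(N·λ_max²)²)`. -/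
theorem lower_bound_for_highly_correlated
    {H F T : Type*} [NormedAddCommGroup H] [InnerProductSpace ℂ H] [CompleteSpace H]
    [NormedAddCommGroup F] [InnerProductSpace ℂ F] [CompleteSpace F]
    [NormedAddCommGroup T] [InnerProductSpace ℂ T] [CompleteSpace T]
    (an : H → F →L[ℂ] F) (hCAR : SatisfiesCAR an)
    (tp : H →ₗ[ℂ] H →ₗ[ℂ] T) (htp : IsHilbertTensorProduct tp)
    (u v : ℕ → H) (lam : ℕ → ℝ) (Φ : T) (hΦnorm : ‖Φ‖ = 1)
    (hΦ : CanonicalWedgeForm tp u v lam Φ)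
    (Ω : F) (hΩ : IsVacuum an Ω)
    (lamMax : ℝ) (hmax : IsGreatest (Set.range lam) lamMax)
    (N : ℕ) (hNeven : Even N) (hsmall : (N : ℝ) * lamMax ^ 2 ≤ 1) :
    ∃ Ψ : F, ‖Ψ‖ = 1 ∧ InSector an u v N Ψ ∧
      ∀ G : T →L[ℂ] T, IsTwoBodyOp tp an Ψ G →
        (((N : ℝ) * (1 - ((N : ℝ) - 2) / 2 * (∑' k : ℕ, lam k ^ 4)
            - 1 / 2 * ((N : ℝ) * lamMax ^ 2) ^ 2) : ℝ) : ℂ) ≤ ⟪Φ, G Φ⟫_ℂ := by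
  obtain ⟨ho, -, hl0, hl2, hΦe⟩ := hΦ
  have hΦs : HasSum (fun k => (lam k : ℂ) • wedgeVec tp (u k) (v k)) Φ := by
    by_cases hs : Summable (fun k => (lam k : ℂ) • wedgeVec tp (u k) (v k))
    · rw [hΦe]; exact hs.hasSum
    · rw [tsum_eq_zero_of_not_summable hs] at hΦe
      rw [hΦe] at hΦnorm; simp at hΦnorm
  have hls : Summable (fun k => lam k ^ 2) := by
    by_contra hs
    rw [tsum_eq_zero_of_not_summable hs] at hl2
    norm_num at hl2
  have hHas : HasSum (fun k => lam k ^ 2) 1 := hl2 ▸ hls.hasSum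
  have hle : ∀ k, lam k ≤ lamMax := fun k => hmax.2 ⟨k, rfl⟩
  have hle2 : ∀ k, lam k ^ 2 ≤ lamMax ^ 2 := fun k => pow_le_pow_left₀ (hl0 k) (hle k) 2
  have hm0 : 0 < lamMax ^ 2 := by
    by_contra hc
    have : ∀ k, lam k ^ 2 = 0 := fun k => le_antisymm ((hle2 k).trans (not_lt.1 hc)) (sq_nonneg _)
    simp only [this] at hl2
    simp at hl2
  set m := lamMax ^ 2 with hm
  have hle4 : ∀ k, lam k ^ 4 ≤ m * lam k ^ 2 := fun k => by
    have := mul_le_mul_of_nonneg_right (hle2 k) (sq_nonneg (lam k))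
    calc lam k ^ 4 = lam k ^ 2 * lam k ^ 2 := by ring
      _ ≤ _ := this
  have hs4 : Summable (fun k => lam k ^ 4) :=
    Summable.of_nonneg_of_le (fun k => by positivity) hle4 (hls.mul_left m)
  set p := ∑' k : ℕ, lam k ^ 4 with hp
  have hpm : p ≤ m := by
    have := hs4.tsum_le_tsum hle4 (hls.mul_left m)
    rwa [tsum_mul_left, hl2, mul_one] at this
  obtain ⟨M, rfl⟩ := hNeven
  rw [← two_mul] at *
  obtain ⟨A, hA⟩ : ∃ A : Finset ℕ, 1 - m ^ 2 ≤ ∑ k ∈ A, lam k ^ 2 := by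
    have h1 : (1 : ℝ) - m ^ 2 < 1 := by nlinarith
    exact ((hHas.eventually (lt_mem_nhds h1)).exists).imp fun _ h => le_of_lt h
  have hpA : ∑ k ∈ A, (lam k ^ 2) ^ 2 ≤ p := by
    have := hs4.sum_le_tsum A (fun k _ => by positivity)
    refine le_trans (le_of_eq ?_) this
    exact Finset.sum_congr rfl fun k _ => by ring
  set x : ℕ → ℝ := fun k => lam k ^ 2 with hx
  have hx0 : ∀ k, 0 ≤ x k := fun k => sq_nonneg _
  have hsm : 2 * (M : ℝ) * m ≤ 1 := by push_cast at hsmall; exact hsmall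
  have hEM := wE_pos x hx0 m hle2 hm0 A hA M hsm M le_rfl
  set Ψ0 := psi0 hCAR (u := u) (v := v) Ω lam A M with hΨ0
  have hn0 : ‖Ψ0‖ ^ 2 = wE x A M := by
    rw [hΨ0, psi0, norm_sum_eS hCAR Ω ho hΩ (fun S => ∏ k ∈ S, lam k), wE]
    exact Finset.sum_congr rfl fun S _ => by rw [← Finset.prod_pow]
  have hnpos : 0 < ‖Ψ0‖ := by
    rcases (norm_nonneg Ψ0).eq_or_lt with h0 | h0
    · rw [← h0] at hn0; norm_num at hn0; linarith
    · exact h0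
  refine ⟨((‖Ψ0‖⁻¹ : ℝ) : ℂ) • Ψ0, ?_, ?_, ?_⟩
  · rw [norm_smul, Complex.norm_real, norm_inv, norm_norm, inv_mul_cancel₀ hnpos.ne']
  · have hsec := sector_psi0 hCAR Ω ho hΩ lam A M
    unfold InSector at hsec ⊢
    simp only [map_smul, ← smul_add]
    rw [tsum_const_smul'', hsec, smul_comm]
  · intro G hG
    have hnm : ∀ k, k ∉ A → an (v k) (an (u k) (((‖Ψ0‖⁻¹ : ℝ) : ℂ) • Ψ0)) = 0 := by
      intro k hk
      rw [map_smul, map_smul, hΨ0, b_psi0_notMem hCAR Ω ho hΩ lam A M k hk, smul_zero]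
    rw [Phi_G hCAR tp _ G hG lam Φ hΦs A hnm, Complex.real_le_real]
    have e1 : ∑ k ∈ A, (lam k : ℂ) • an (v k) (an (u k) (((‖Ψ0‖⁻¹ : ℝ) : ℂ) • Ψ0))
        = ((‖Ψ0‖⁻¹ : ℝ) : ℂ) • ∑ k ∈ A, (lam k : ℂ) • an (v k) (an (u k) Ψ0) := by
      rw [Finset.smul_sum]
      exact Finset.sum_congr rfl fun k _ => by rw [map_smul, map_smul, smul_comm]
    rw [e1, norm_smul, Complex.norm_real, norm_inv, norm_norm, mul_pow ‖Ψ0‖⁻¹, inv_pow, hn0]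
    cases M with
    | zero => simp; positivity
    | succ j =>
      rw [hΨ0, B_psi0 hCAR Ω ho hΩ,
        norm_sum_eS hCAR Ω ho hΩ (fun R => (∏ k ∈ R, lam k) * ∑ k ∈ A \ R, lam k ^ 2)]
      set Q := ∑ R ∈ Finset.powersetCard j A,
        ((∏ k ∈ R, lam k) * ∑ k ∈ A \ R, lam k ^ 2) ^ 2 with hQ
      have hsm' : 2 * ((j : ℝ) + 1) * m ≤ 1 := by push_cast at hsm; exact hsm
      have hEj := wE_pos x hx0 m hle2 hm0 A hA (j+1) hsm j (by omega)
      have hmain := wE_main x hx0 m hle2 hm0 A hA j hsm' p hpA hpm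
      have hCS : (((j : ℝ) + 1) * wE x A (j+1)) ^ 2 ≤ wE x A j * Q := by
        have := Finset.sum_mul_sq_le_sq_mul_sq (Finset.powersetCard j A)
          (fun R => ∏ k ∈ R, lam k) (fun R => (∏ k ∈ R, lam k) * ∑ k ∈ A \ R, lam k ^ 2)
        have q1 : ∀ R : Finset ℕ, ∏ k ∈ R, x k = (∏ k ∈ R, lam k) ^ 2 := fun R => by
          rw [← Finset.prod_pow]
        have q2 : ((j : ℝ) + 1) * wE x A (j+1) = ∑ R ∈ Finset.powersetCard j A,
            (∏ k ∈ R, lam k) * ((∏ k ∈ R, lam k) * ∑ k ∈ A \ R, lam k ^ 2) := by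
          rw [wE_succ]
          refine Finset.sum_congr rfl fun R _ => ?_
          rw [q1, sq, mul_assoc]
        have q3 : wE x A j = ∑ R ∈ Finset.powersetCard j A, (∏ k ∈ R, lam k) ^ 2 :=
          Finset.sum_congr rfl fun R _ => q1 R
        rw [q2, q3]
        exact this
      set a := wE x A j
      set b := wE x A (j+1)
      set c := 1 - j * p - 2 * (((j : ℝ) + 1) * m)^2 with hc
      have hj1 : (0 : ℝ) < (j : ℝ) + 1 := by positivity
      have hfin : ((j : ℝ) + 1) * c * b ≤ Q := by
        have : a * (((j : ℝ) + 1) * c * b) ≤ a * Q := by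
          refine le_trans ?_ hCS
          have := mul_le_mul_of_nonneg_left hmain (mul_pos hj1 hEM).le
          nlinarith
        exact le_of_mul_le_mul_left this hEj
      have hfin2 : ((j : ℝ) + 1) * c ≤ b⁻¹ * Q := by
        rw [inv_mul_eq_div, le_div_iff₀ hEM]; exact hfin
      push_cast
      calc _ = 2 * (((j : ℝ) + 1) * c) := by rw [hc]; ring
        _ ≤ _ := by linarith
end
end

section
/- Let Φ = Σ_{k=1}^∞ λ_k u_k ∧ v_k be a canonical form of a normalized Φ ∈ h∧h, let λ_max := max_k λ_k, let B = Σ_{k=1}^∞ λ_k c_{k,↓} c_{k,↑}, and let Ψ_M = (B*)^M Ω. Then for all M ∈ ℕ: (1 − (M−1)·λ_max²)·M·‖Ψ_{M−1}‖² ≤ ‖Ψ_M‖² ≤ M·‖Ψ_{M−1}‖². -/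
/- Setting: `H` is the one-particle Hilbert space `h`, `F` is the fermionic Fock space over
`h` (carrying annihilation operators `an f = c(f)` satisfying the CAR, with adjoints the
creation operators `c*(f)`, and vacuum `Ω`), and `T` is the two-particle space `h ⊗ h`
(realized by a bilinear map `tp`, with the antisymmetric tensors `h ∧ h` inside it). -/

open scoped ComplexOrder

open ContinuousLinearMap

noncomputable section

section Alg
variable {R : Type*} [Ring R]
lemma ac_comm {a b x : R} (h1 : a * x = -(x * a)) (h2 : b * x = -(x * b)) : (a * b) * x = x * (a * b) := by
  rw [mul_assoc, h2, mul_neg, ← mul_assoc, h1, neg_mul, neg_neg, mul_assoc]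
lemma ac_comm2 {a b c d : R} (h1 : a * c = -(c * a)) (h2 : b * c = -(c * b))
    (h3 : a * d = -(d * a)) (h4 : b * d = -(d * b)) : (a * b) * (c * d) = (c * d) * (a * b) := by
  rw [← mul_assoc, ac_comm h1 h2, mul_assoc, ac_comm h3 h4, mul_assoc]
/-- the partial isometry identity -/
lemma ac_pi {a b a' b' : R} (haa : a * a' + a' * a = 1) (hbb : b * b' + b' * b = 1)
    (ha : a' * a' = 0) (hb : b' * b' = 0)
    (h1 : b * a = -(a * b)) (h2 : b * a' = -(a' * b)) (h3 : b' * a = -(a * b')) 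
    (h4 : b' * a' = -(a' * b')) :
    (a' * b') * (b * a) * (a' * b') = a' * b' := by
  have e1 : a' * a * a' = a' := by
    have : a' * (a * a' + a' * a) = a' := by rw [haa, mul_one]
    rw [mul_add, ← mul_assoc, ← mul_assoc, ha, zero_mul, add_zero] at this
    exact this
  have e2 : b' * b * b' = b' := by
    have : b' * (b * b' + b' * b) = b' := by rw [hbb, mul_one]
    rw [mul_add, ← mul_assoc, ← mul_assoc, hb, zero_mul, add_zero] at this
    exact this
  calc (a' * b') * (b * a) * (a' * b') = a' * ((b' * b) * (a * a')) * b' := by noncomm_ring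
    _ = a' * ((a * a') * (b' * b)) * b' := by rw [ac_comm2 h3 h1 h4 h2]
    _ = (a' * a * a') * (b' * b * b') := by noncomm_ring
    _ = a' * b' := by rw [e1, e2]
end Alg

section Core

/-- algebraic properties of the pair creation operators -/
structure PairAlg {F : Type*} [NormedAddCommGroup F] [InnerProductSpace ℂ F]
    (A P : ℕ → F →L[ℂ] F) (Ω : F) : Prop where
  adj : ∀ k x y, ⟪A k x, y⟫_ℂ = ⟪x, P k y⟫_ℂ
  comm : ∀ k l x, A k (A l x) = A l (A k x)
  sq : ∀ k x, A k (A k x) = 0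
  cross : ∀ k l x, k ≠ l → P l (A k x) = A k (P l x)
  pi : ∀ k x, A k (P k (A k x)) = A k x
  vac : ∀ k, P k Ω = 0
  vac2 : ∀ k, P k (A k Ω) = Ω

variable {F : Type*} [NormedAddCommGroup F] [InnerProductSpace ℂ F]

lemma norm_le_of_inner_self {x y : F} (h : ⟪y, y⟫_ℂ = ⟪x, y⟫_ℂ) : ‖y‖ ≤ ‖x‖ := by
  have h2 : ‖y‖ * ‖y‖ ≤ ‖x‖ * ‖y‖ := by
    have h3 : ‖⟪y, y⟫_ℂ‖ = ‖y‖ * ‖y‖ := by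
      rw [inner_self_eq_norm_sq_to_K]; simp [sq]
    rw [← h3, h]
    exact norm_inner_le_norm _ _
  by_contra hc
  push Not at hc
  nlinarith [norm_nonneg x]

namespace PairAlg
variable {A P : ℕ → F →L[ℂ] F} {Ω : F}

lemma adj' (h : PairAlg A P Ω) (k x y) : ⟪P k x, y⟫_ℂ = ⟪x, A k y⟫_ℂ := by
  rw [← inner_conj_symm, ← h.adj, inner_conj_symm]

lemma normAP (h : PairAlg A P Ω) (k x) : ‖A k (P k x)‖ ≤ ‖x‖ := by
  apply norm_le_of_inner_self
  rw [h.adj, h.adj', h.pi]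

lemma normPA (h : PairAlg A P Ω) (k x) : ‖P k (A k x)‖ ≤ ‖x‖ := by
  apply norm_le_of_inner_self
  rw [h.adj', h.pi, h.adj]

lemma inner_bound (h : PairAlg A P Ω) {lam : ℕ → ℝ} (h0 : ∀ k, 0 ≤ lam k) {ψ : F} {C : ℝ}
    (hC : ∀ k, ‖P k ψ‖ ≤ C * lam k) (k l : ℕ) :
    ‖⟪A k ψ, A l ψ⟫_ℂ‖ ≤ (if k = l then ‖ψ‖ ^ 2 else 0) + C ^ 2 * (lam k * lam l) := by
  by_cases hkl : k = l
  · subst hkl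
    rw [if_pos rfl, h.adj]
    have := norm_inner_le_norm (𝕜 := ℂ) ψ (P k (A k ψ))
    have h2 := h.normPA k ψ
    have h3 : 0 ≤ C ^ 2 * (lam k * lam k) := by have := h0 k; positivity
    nlinarith [norm_nonneg ψ]
  · rw [if_neg hkl, h.adj, h.cross l k ψ (Ne.symm hkl), ← h.adj', zero_add]
    refine (norm_inner_le_norm _ _).trans ?_
    calc ‖P l ψ‖ * ‖P k ψ‖ ≤ (C * lam l) * (C * lam k) :=
          mul_le_mul (hC l) (hC k) (norm_nonneg _) ((norm_nonneg _).trans (hC l))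
      _ = _ := by ring

lemma sum_bound (h : PairAlg A P Ω) {lam : ℕ → ℝ} (h0 : ∀ k, 0 ≤ lam k) {ψ : F} {C : ℝ}
    (hC : ∀ k, ‖P k ψ‖ ≤ C * lam k) (S : Finset ℕ) :
    ‖∑ k ∈ S, (lam k : ℂ) • A k ψ‖ ^ 2 ≤
      (∑ k ∈ S, lam k ^ 2) * ‖ψ‖ ^ 2 + C ^ 2 * (∑ k ∈ S, lam k ^ 2) ^ 2 := by
  have e : ‖∑ k ∈ S, (lam k : ℂ) • A k ψ‖ ^ 2 =
      ‖⟪∑ k ∈ S, (lam k : ℂ) • A k ψ, ∑ k ∈ S, (lam k : ℂ) • A k ψ⟫_ℂ‖ := by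
    rw [inner_self_eq_norm_sq_to_K]; simp
  rw [e, sum_inner]
  calc ‖∑ k ∈ S, ⟪(lam k : ℂ) • A k ψ, ∑ l ∈ S, (lam l : ℂ) • A l ψ⟫_ℂ‖
      ≤ ∑ k ∈ S, ∑ l ∈ S, ‖⟪(lam k : ℂ) • A k ψ, (lam l : ℂ) • A l ψ⟫_ℂ‖ := by
        refine (norm_sum_le _ _).trans (Finset.sum_le_sum fun k _ => ?_)
        rw [inner_sum]
        exact norm_sum_le _ _
    _ ≤ ∑ k ∈ S, ∑ l ∈ S, ((if k = l then lam k ^ 2 * ‖ψ‖ ^ 2 else 0)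
          + C ^ 2 * (lam k ^ 2 * lam l ^ 2)) := by
        refine Finset.sum_le_sum fun k _ => Finset.sum_le_sum fun l _ => ?_
        have hb := h.inner_bound h0 hC k l
        rw [inner_smul_left, inner_smul_right, norm_mul, norm_mul]
        simp only [RCLike.norm_conj, Complex.norm_real, Real.norm_of_nonneg (h0 _)]
        have := mul_le_mul_of_nonneg_left hb (mul_nonneg (h0 k) (h0 l))
        rw [← mul_assoc]
        refine this.trans (le_of_eq ?_)
        split_ifs with hkl
        · subst hkl; ring
        · ring
    _ = _ := by
        simp only [Finset.sum_add_distrib, Finset.sum_ite_eq]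
        congr 1
        · rw [Finset.sum_mul]
          exact Finset.sum_congr rfl fun k hk => by rw [if_pos hk]
        · rw [pow_two (∑ k ∈ S, lam k ^ 2), Finset.sum_mul_sum, Finset.mul_sum]
          simp only [Finset.mul_sum]

lemma summable [CompleteSpace F] (h : PairAlg A P Ω) {lam : ℕ → ℝ} (h0 : ∀ k, 0 ≤ lam k)
    (hs : Summable fun k => lam k ^ 2) {ψ : F} {C : ℝ}
    (hC : ∀ k, ‖P k ψ‖ ≤ C * lam k) : Summable fun k => (lam k : ℂ) • A k ψ := by
  rw [summable_iff_vanishing_norm] at hs ⊢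
  intro ε hε
  have hD : 0 < ‖ψ‖ ^ 2 + C ^ 2 + 1 := by positivity
  obtain ⟨s, hs⟩ := hs (min 1 (ε ^ 2 / (‖ψ‖ ^ 2 + C ^ 2 + 1))) (by positivity)
  refine ⟨s, fun t ht => ?_⟩
  have h1 := hs t ht
  have hσ : 0 ≤ ∑ k ∈ t, lam k ^ 2 := Finset.sum_nonneg fun _ _ => sq_nonneg _
  rw [Real.norm_of_nonneg hσ, lt_min_iff, lt_div_iff₀ hD] at h1
  have h2 := h.sum_bound h0 hC t
  set σ := ∑ k ∈ t, lam k ^ 2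
  refine lt_of_pow_lt_pow_left₀ 2 hε.le (h2.trans_lt (lt_of_le_of_lt ?_ h1.2))
  have : C ^ 2 * σ ^ 2 ≤ C ^ 2 * σ := by
    apply mul_le_mul_of_nonneg_left _ (sq_nonneg C); nlinarith [h1.1]
  nlinarith

/-- abstract states -/
noncomputable def Psi (A : ℕ → F →L[ℂ] F) (lam : ℕ → ℝ) (Ω : F) : ℕ → F
  | 0 => Ω
  | M + 1 => ∑' k, (lam k : ℂ) • A k (Psi A lam Ω M)

lemma main [CompleteSpace F] (h : PairAlg A P Ω) {lam : ℕ → ℝ} (h0 : ∀ k, 0 ≤ lam k)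
    (hs : Summable fun k => lam k ^ 2) (M : ℕ) :
    (Summable fun k => (lam k : ℂ) • A k (Psi A lam Ω M)) ∧
    (∀ l, P l (A l (Psi A lam Ω M)) = Psi A lam Ω M - A l (P l (Psi A lam Ω M))) ∧
    (∀ l, P l (Psi A lam Ω (M + 1)) =
      (((M : ℂ) + 1) * (lam l : ℂ)) • (Psi A lam Ω M - A l (P l (Psi A lam Ω M)))) := by
  induction M with
  | zero =>
    have s0 : Summable fun k => (lam k : ℂ) • A k (Psi A lam Ω 0) :=
      h.summable h0 hs (C := 0) (fun k => by simp [Psi, h.vac])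
    refine ⟨s0, fun l => by simp [Psi, h.vac, h.vac2], fun l => ?_⟩
    change P l (∑' k, (lam k : ℂ) • A k (Psi A lam Ω 0)) = _
    rw [ContinuousLinearMap.map_tsum _ s0, tsum_eq_single l]
    · simp [Psi, h.vac, h.vac2]
    · intro k hk
      simp [Psi, h.cross k l _ hk, h.vac]
  | succ M ih =>
    obtain ⟨s, hQ, hP⟩ := ih
    have hdef : Psi A lam Ω (M + 1) = ∑' k, (lam k : ℂ) • A k (Psi A lam Ω M) := rfl
    have hS : HasSum (fun k => (lam k : ℂ) • A k (Psi A lam Ω M)) (Psi A lam Ω (M + 1)) := by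
      rw [hdef]; exact s.hasSum
    have s' : Summable fun k => (lam k : ℂ) • A k (Psi A lam Ω (M + 1)) := by
      refine h.summable h0 hs (C := (M + 1) * (2 * ‖Psi A lam Ω M‖)) fun l => ?_
      rw [hP l, norm_smul, norm_mul, Complex.norm_real, Real.norm_of_nonneg (h0 l)]
      have e1 : ‖(M : ℂ) + 1‖ = (M : ℝ) + 1 := by
        rw [← Nat.cast_succ, Complex.norm_natCast]; simp
      have e2 := norm_sub_le (Psi A lam Ω M) (A l (P l (Psi A lam Ω M)))
      have e3 := h.normAP l (Psi A lam Ω M)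
      rw [e1]
      have e4 : 0 ≤ ((M : ℝ) + 1) * lam l := mul_nonneg (by positivity) (h0 l)
      calc _ ≤ ((M : ℝ) + 1) * lam l * (2 * ‖Psi A lam Ω M‖) :=
            mul_le_mul_of_nonneg_left (by linarith) e4
        _ = _ := by ring
    have hQ' : ∀ l, P l (A l (Psi A lam Ω (M + 1))) =
        Psi A lam Ω (M + 1) - A l (P l (Psi A lam Ω (M + 1))) := by
      intro l
      rw [eq_sub_iff_add_eq]
      have h1 := (hS.mapL (A l)).mapL (P l)
      have h2 := (hS.mapL (P l)).mapL (A l)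
      refine (h1.add h2).unique ?_
      convert hS using 1
      funext k
      simp only [map_smul]
      rw [← smul_add]
      congr 1
      by_cases hk : k = l
      · subst hk
        rw [h.sq, map_zero, h.pi, zero_add]
      · rw [h.comm l k, h.cross k l _ hk, h.cross k l _ hk, h.comm l k, ← map_add, hQ l,
          sub_add_cancel]
    refine ⟨s', hQ', fun l => ?_⟩
    have hS' : HasSum (fun k => (lam k : ℂ) • A k (Psi A lam Ω (M + 1))) (Psi A lam Ω (M + 2)) :=
      s'.hasSum
    have h1 := hS'.mapL (P l)
    have h2 := (hS.sub ((hS.mapL (P l)).mapL (A l))).const_smul (((M : ℂ) + 1) * (lam l : ℂ))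
    have h3 := hasSum_ite_eq l
      ((lam l : ℂ) • (Psi A lam Ω (M + 1) - A l (P l (Psi A lam Ω (M + 1)))))
    have h4 := h2.add h3
    refine h1.unique ?_
    convert h4 using 1
    · funext k
      simp only [map_smul]
      by_cases hk : k = l
      · subst hk
        rw [if_pos rfl, hQ', h.pi, sub_self, smul_zero, zero_add]
      · rw [if_neg hk, h.cross k l _ hk, h.cross k l _ hk, hP l, add_zero, h.comm l k, ← smul_sub,
          ← map_sub, map_smul, smul_comm]
    · push_cast
      module

lemma hasSum_normP [CompleteSpace F] (h : PairAlg A P Ω) {lam : ℕ → ℝ} (h0 : ∀ k, 0 ≤ lam k)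
    (hs : Summable fun k => lam k ^ 2) (M : ℕ) :
    HasSum (fun k => ‖P k (Psi A lam Ω M)‖ ^ 2) (M * ‖Psi A lam Ω M‖ ^ 2) := by
  cases M with
  | zero => simp [Psi, h.vac, hasSum_zero]
  | succ M =>
    obtain ⟨s, hQ, hP⟩ := h.main h0 hs M
    have hS : HasSum (fun k => (lam k : ℂ) • A k (Psi A lam Ω M)) (Psi A lam Ω (M + 1)) :=
      s.hasSum
    have h1 := (hS.const_smul ((M : ℂ) + 1)).mapL (innerSL ℂ (Psi A lam Ω (M + 1)))
    have h2 := h1.mapL Complex.reCLM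
    convert h2 using 1
    · funext k
      have : ((M : ℂ) + 1) • (lam k : ℂ) • A k (Psi A lam Ω M)
          = A k (P k (Psi A lam Ω (M + 1))) := by
        rw [hP k, map_smul, map_sub, h.sq, sub_zero, smul_smul]
      rw [this, innerSL_apply_apply, ← h.adj', inner_self_eq_norm_sq_to_K]
      norm_cast
    · rw [innerSL_apply_apply, inner_smul_right, inner_self_eq_norm_sq_to_K, Complex.reCLM_apply]
      rw [← Complex.ofReal_re (((M + 1 : ℕ) : ℝ) * ‖Psi A lam Ω (M + 1)‖ ^ 2)]
      congr 1
      push_cast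
      rfl

lemma hasSum_norm [CompleteSpace F] (h : PairAlg A P Ω) {lam : ℕ → ℝ} (h0 : ∀ k, 0 ≤ lam k)
    (hs : Summable fun k => lam k ^ 2) (M : ℕ) :
    HasSum (fun k => ((M : ℝ) + 1) * (lam k ^ 2 *
      (‖Psi A lam Ω M‖ ^ 2 - ‖P k (Psi A lam Ω M)‖ ^ 2))) (‖Psi A lam Ω (M + 1)‖ ^ 2) := by
  obtain ⟨s, hQ, hP⟩ := h.main h0 hs M
  have hS : HasSum (fun k => (lam k : ℂ) • A k (Psi A lam Ω M)) (Psi A lam Ω (M + 1)) :=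
    s.hasSum
  have h2 := (hS.mapL (innerSL ℂ (Psi A lam Ω (M + 1)))).mapL Complex.reCLM
  convert h2 using 1
  · funext k
    rw [innerSL_apply_apply, inner_smul_right, ← h.adj', hP k, inner_smul_left, inner_sub_left,
      h.adj, inner_self_eq_norm_sq_to_K, inner_self_eq_norm_sq_to_K]
    simp only [Complex.reCLM_apply, map_mul, map_add, map_natCast, map_one, Complex.conj_ofReal]
    rw [← Complex.ofReal_re (((M : ℝ) + 1) * (lam k ^ 2 *
      (‖Psi A lam Ω M‖ ^ 2 - ‖P k (Psi A lam Ω M)‖ ^ 2)))]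
    congr 1
    push_cast
    simp only [Complex.coe_algebraMap]
    ring
  · rw [innerSL_apply_apply, inner_self_eq_norm_sq_to_K]
    simp only [Complex.reCLM_apply]
    norm_cast

lemma bounds [CompleteSpace F] (h : PairAlg A P Ω) {lam : ℕ → ℝ} (h0 : ∀ k, 0 ≤ lam k)
    (hs : HasSum (fun k => lam k ^ 2) 1) {L : ℝ} (hL : ∀ k, lam k ≤ L) (M : ℕ) :
    (1 - (M : ℝ) * L ^ 2) * ((M : ℝ) + 1) * ‖Psi A lam Ω M‖ ^ 2 ≤ ‖Psi A lam Ω (M + 1)‖ ^ 2 ∧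
    ‖Psi A lam Ω (M + 1)‖ ^ 2 ≤ ((M : ℝ) + 1) * ‖Psi A lam Ω M‖ ^ 2 := by
  have h1 := h.hasSum_normP h0 hs.summable M
  have h2 := h.hasSum_norm h0 hs.summable M
  have h3 := hs.mul_right (‖Psi A lam Ω M‖ ^ 2)
  have hM : (0 : ℝ) ≤ (M : ℝ) + 1 := by positivity
  constructor
  · have h4 := (h3.sub (h1.mul_left (L ^ 2))).mul_left ((M : ℝ) + 1)
    have h5 := hasSum_le (fun k => ?_) h4 h2
    · refine le_trans (le_of_eq ?_) h5
      ring
    · apply mul_le_mul_of_nonneg_left _ hM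
      have : lam k ^ 2 ≤ L ^ 2 := pow_le_pow_left₀ (h0 k) (hL k) 2
      have := mul_le_mul_of_nonneg_right this (sq_nonneg ‖P k (Psi A lam Ω M)‖)
      linarith
  · have h5 := hasSum_le (fun k => ?_) h2 (h3.mul_left ((M : ℝ) + 1))
    · rwa [one_mul] at h5
    · apply mul_le_mul_of_nonneg_left _ hM
      have := mul_nonneg (sq_nonneg (lam k)) (sq_nonneg ‖P k (Psi A lam Ω M)‖)
      linarith

end PairAlg
end Core

lemma pairAlg_of_CAR {H F : Type*} [NormedAddCommGroup H] [InnerProductSpace ℂ H]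
    [NormedAddCommGroup F] [InnerProductSpace ℂ F] [CompleteSpace F]
    (an : H → F →L[ℂ] F) (hCAR : SatisfiesCAR an) (u v : ℕ → H)
    (ho : Orthonormal ℂ (Sum.elim u v)) (Ω : F) (hΩ : ∀ f, an f Ω = 0) :
    PairAlg (fun k => adjoint (an (u k)) * adjoint (an (v k))) (fun k => an (v k) * an (u k)) Ω := by
  obtain ⟨h1, h2⟩ := hCAR
  have c1 : ∀ f g, an f * an g = -(an g * an f) := fun f g => eq_neg_of_add_eq_zero_left (h1 f g)
  have c2 : ∀ f g, adjoint (an f) * adjoint (an g) = -(adjoint (an g) * adjoint (an f)) := by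
    intro f g
    have := congrArg star (c1 g f)
    simpa only [star_mul, star_neg, star_eq_adjoint] using this
  have c3 : ∀ f g, ⟪f, g⟫_ℂ = 0 → an f * adjoint (an g) = -(adjoint (an g) * an f) := by
    intro f g hfg
    have := h2 f g
    rw [hfg, zero_smul] at this
    exact eq_neg_of_add_eq_zero_left this
  have c3' : ∀ f g, ⟪f, g⟫_ℂ = 0 → adjoint (an g) * an f = -(an f * adjoint (an g)) := by
    intro f g hfg
    rw [c3 f g hfg, neg_neg]
  have c4 : ∀ f, ⟪f, f⟫_ℂ = 1 → an f * adjoint (an f) + adjoint (an f) * an f = 1 := by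
    intro f hf
    have := h2 f f
    rw [hf, one_smul] at this
    exact this
  have c5 : ∀ f, adjoint (an f) * adjoint (an f) = 0 := fun f => by
    have h3 := c2 f f
    rw [eq_neg_iff_add_eq_zero, ← two_smul ℂ] at h3
    exact (smul_eq_zero.mp h3).resolve_left two_ne_zero
  have o := orthonormal_iff_ite.mp ho
  have ouu : ∀ k l, k ≠ l → ⟪u k, u l⟫_ℂ = 0 := fun k l hkl => by
    simpa [hkl] using o (Sum.inl k) (Sum.inl l)
  have ovv : ∀ k l, k ≠ l → ⟪v k, v l⟫_ℂ = 0 := fun k l hkl => by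
    simpa [hkl] using o (Sum.inr k) (Sum.inr l)
  have ouv : ∀ k l, ⟪u k, v l⟫_ℂ = 0 := fun k l => by
    simpa using o (Sum.inl k) (Sum.inr l)
  have ovu : ∀ k l, ⟪v k, u l⟫_ℂ = 0 := fun k l => by
    simpa using o (Sum.inr k) (Sum.inl l)
  have ou : ∀ k, ⟪u k, u k⟫_ℂ = 1 := fun k => by
    simpa using o (Sum.inl k) (Sum.inl k)
  have ov : ∀ k, ⟪v k, v k⟫_ℂ = 1 := fun k => by
    simpa using o (Sum.inr k) (Sum.inr k)
  refine ⟨?_, ?_, ?_, ?_, ?_, ?_, ?_⟩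
  · intro k x y
    simp only [mul_apply_eq_comp, adjoint_inner_left]
  · intro k l x
    exact DFunLike.congr_fun (ac_comm2 (c2 (u k) (u l)) (c2 (v k) (u l)) (c2 (u k) (v l))
      (c2 (v k) (v l))) x
  · intro k x
    have e : (adjoint (an (u k)) * adjoint (an (v k))) * (adjoint (an (u k)) * adjoint (an (v k)))
        = 0 := by
      calc _ = adjoint (an (u k)) * (adjoint (an (v k)) * adjoint (an (u k))) *
            adjoint (an (v k)) := by noncomm_ring
        _ = -((adjoint (an (u k)) * adjoint (an (u k))) * adjoint (an (v k)) *
            adjoint (an (v k))) := by rw [c2 (v k) (u k)]; noncomm_ring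
        _ = 0 := by rw [c5]; simp
    exact DFunLike.congr_fun e x
  · intro k l x hkl
    exact DFunLike.congr_fun (ac_comm2 (c3 (v l) (u k) (ovu l k)) (c3 (u l) (u k) (ouu l k hkl.symm))
      (c3 (v l) (v k) (ovv l k hkl.symm)) (c3 (u l) (v k) (ouv l k))) x
  · intro k x
    have e := ac_pi (c4 _ (ou k)) (c4 _ (ov k)) (c5 (u k)) (c5 (v k)) (c1 (v k) (u k))
      (c3 _ _ (ovu k k)) (c3' _ _ (ouv k k)) (c2 (v k) (u k))
    exact DFunLike.congr_fun e x
  · intro k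
    change an (v k) (an (u k) Ω) = 0
    rw [hΩ, map_zero]
  · intro k
    have e : (an (v k) * an (u k)) * (adjoint (an (u k)) * adjoint (an (v k)))
        = 1 - adjoint (an (v k)) * an (v k) - an (v k) * adjoint (an (u k)) *
          (-(adjoint (an (v k)) * an (u k))) := by
      rw [← c3 _ _ (ouv k k), ← eq_sub_of_add_eq (c4 _ (ov k))]
      have := eq_sub_of_add_eq (c4 _ (ou k))
      calc _ = an (v k) * (an (u k) * adjoint (an (u k))) * adjoint (an (v k)) := by noncomm_ring
        _ = _ := by rw [this]; noncomm_ring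
    refine (DFunLike.congr_fun e Ω).trans ?_
    simp [hΩ]

/-- **Proposition 3 (norm recursion).** For all `M ∈ ℕ` (stated here for `M + 1`, i.e.
with `Ψ_{M+1}` and `Ψ_M` in place of the paper's `Ψ_M` and `Ψ_{M-1}`):
`(1 - M·λ_max²)·(M+1)·‖Ψ_M‖² ≤ ‖Ψ_{M+1}‖² ≤ (M+1)·‖Ψ_M‖²`. -/
theorem PsiM_norm_recursion
    {H F T : Type*} [NormedAddCommGroup H] [InnerProductSpace ℂ H] [CompleteSpace H]
    [NormedAddCommGroup F] [InnerProductSpace ℂ F] [CompleteSpace F]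
    [NormedAddCommGroup T] [InnerProductSpace ℂ T] [CompleteSpace T]
    (an : H → F →L[ℂ] F) (hCAR : SatisfiesCAR an)
    (tp : H →ₗ[ℂ] H →ₗ[ℂ] T) (htp : IsHilbertTensorProduct tp)
    (u v : ℕ → H) (lam : ℕ → ℝ) (Φ : T) (hΦnorm : ‖Φ‖ = 1)
    (hΦ : CanonicalWedgeForm tp u v lam Φ)
    (Ω : F) (hΩ : IsVacuum an Ω)
    (lamMax : ℝ) (hmax : IsGreatest (Set.range lam) lamMax) :
    ∀ M : ℕ,
      (1 - (M : ℝ) * lamMax ^ 2) * ((M : ℝ) + 1) * ‖PsiM an u v lam Ω M‖ ^ 2 ≤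
          ‖PsiM an u v lam Ω (M + 1)‖ ^ 2 ∧
        ‖PsiM an u v lam Ω (M + 1)‖ ^ 2 ≤ ((M : ℝ) + 1) * ‖PsiM an u v lam Ω M‖ ^ 2 := by
  obtain ⟨ho, -, h0, hsum, -⟩ := hΦ
  have hs : Summable fun k => lam k ^ 2 := by
    by_contra hc
    rw [tsum_eq_zero_of_not_summable hc] at hsum
    exact zero_ne_one hsum
  have hs1 : HasSum (fun k => lam k ^ 2) 1 := hsum ▸ hs.hasSum
  have hA := pairAlg_of_CAR an hCAR u v ho Ω hΩ.2
  have hPsi : ∀ M, PsiM an u v lam Ω M =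
      PairAlg.Psi (fun k => adjoint (an (u k)) * adjoint (an (v k))) lam Ω M := by
    intro M
    induction M with
    | zero => rfl
    | succ M ih =>
      change applyBd an u v lam (PsiM an u v lam Ω M) = _
      rw [ih]
      rfl
  intro M
  rw [hPsi, hPsi]
  exact hA.bounds h0 hs1 (fun k => hmax.2 ⟨k, rfl⟩) M
end
end

section
/- Let Φ = Σ_{k=1}^∞ λ_k u_k ∧ v_k be a canonical form of a normalized Φ ∈ h∧h, let B = Σ_{k=1}^∞ λ_k c_{k,↓} c_{k,↑}, and let Ψ_M = (B*)^M Ω. Then for every M ∈ ℕ, every k ∈ ℕ and σ ∈ {↑,↓}: (λ_k·c*_{k,σ} ±_σ (M+1)^{-1}·c_{k,σ̄}·B*) Ψ_M = 0. -/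
/- Setting: `H` is the one-particle Hilbert space `h`, `F` is the fermionic Fock space over
`h` (carrying annihilation operators `an f = c(f)` satisfying the CAR, with adjoints the
creation operators `c*(f)`, and vacuum `Ω`), and `T` is the two-particle space `h ⊗ h`
(realized by a bilinear map `tp`, with the antisymmetric tensors `h ∧ h` inside it). -/

open scoped ComplexOrder

open ContinuousLinearMap

noncomputable section

theorem hasSum_pt {F : Type*} [NormedAddCommGroup F] {f g : ℕ → F} {s : F}
    (hf : HasSum f s) (h : ∀ k, g k = f k) : HasSum g s := by
  rwa [funext h]

theorem aux_summable {F : Type*} [NormedAddCommGroup F] [InnerProductSpace ℂ F] [CompleteSpace F]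
    (x : ℕ → F) (a : ℕ → ℝ) (ha0 : ∀ k, 0 ≤ a k) (ha : Summable a) (C D : ℝ) (hC : 0 ≤ C)
    (hD : 0 ≤ D) (h : ∀ k l, k ≠ l → ‖⟪x k, x l⟫_ℂ‖ ≤ C * (a k * a l))
    (h2 : ∀ k, ‖⟪x k, x k⟫_ℂ‖ ≤ D * a k) : Summable x := by
  rw [summable_iff_vanishing_norm] at ha ⊢
  intro ε hε
  have hCD : 0 < C + D + 1 := by positivity
  obtain ⟨s, hs⟩ := ha (min 1 (ε ^ 2 / (C + D + 1))) (by positivity)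
  refine ⟨s, fun t ht => ?_⟩
  have h3 := hs t ht
  set A := ∑ i ∈ t, a i with hA
  have hA0 : 0 ≤ A := Finset.sum_nonneg fun i _ => ha0 i
  rw [Real.norm_of_nonneg hA0, lt_min_iff, lt_div_iff₀ hCD] at h3
  have hb : ‖∑ i ∈ t, x i‖ ^ 2 ≤ C * (A * A) + D * A := by
    have e1 : ‖∑ i ∈ t, x i‖ ^ 2 = ‖⟪∑ i ∈ t, x i, ∑ i ∈ t, x i⟫_ℂ‖ := by
      rw [inner_self_eq_norm_sq_to_K]; simp
    rw [e1, sum_inner]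
    calc ‖∑ i ∈ t, ⟪x i, ∑ j ∈ t, x j⟫_ℂ‖ ≤ ∑ i ∈ t, ∑ j ∈ t, ‖⟪x i, x j⟫_ℂ‖ := by
          refine (norm_sum_le _ _).trans (Finset.sum_le_sum fun i _ => ?_)
          rw [inner_sum]; exact norm_sum_le _ _
      _ ≤ ∑ i ∈ t, ∑ j ∈ t, (C * (a i * a j) + if i = j then D * a i else 0) := by
          refine Finset.sum_le_sum fun i _ => Finset.sum_le_sum fun j _ => ?_
          by_cases hij : i = j
          · subst hij
            have := h2 i
            have h5 : 0 ≤ C * (a i * a i) := by have := ha0 i; positivity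
            simp only [if_true]; linarith
          · simpa [hij] using h i j hij
      _ = C * (A * A) + D * A := by
          simp only [Finset.sum_add_distrib]
          congr 1
          · rw [hA, Finset.sum_mul_sum, Finset.mul_sum]
            exact Finset.sum_congr rfl fun i _ => by rw [Finset.mul_sum]
          · rw [hA, Finset.mul_sum]
            refine Finset.sum_congr rfl fun i hi => ?_
            simp [hi]
  refine lt_of_pow_lt_pow_left₀ 2 hε.le ?_
  have : C * (A * A) ≤ C * A := mul_le_mul_of_nonneg_left (by nlinarith) hC
  nlinarith

section CARlemmas
variable {H F : Type*} [NormedAddCommGroup H] [InnerProductSpace ℂ H]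
    [NormedAddCommGroup F] [InnerProductSpace ℂ F] [CompleteSpace F]
    {an : H → F →L[ℂ] F}

theorem car_aa (hCAR : SatisfiesCAR an) (f g : H) (x : F) : an f (an g x) = - an g (an f x) := by
  have := congrArg (fun T : F →L[ℂ] F => T x) (hCAR.1 f g)
  simp only [ContinuousLinearMap.add_apply, ContinuousLinearMap.comp_apply,
    ContinuousLinearMap.zero_apply] at this
  exact eq_neg_of_add_eq_zero_left this

theorem car_cc (hCAR : SatisfiesCAR an) (f g : H) (x : F) :
    adjoint (an f) (adjoint (an g) x) = - adjoint (an g) (adjoint (an f) x) := by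
  refine ext_inner_left ℂ fun y => ?_
  rw [inner_neg_right]
  simp only [ContinuousLinearMap.adjoint_inner_right]
  rw [car_aa hCAR, inner_neg_left]

theorem car_ac (hCAR : SatisfiesCAR an) (f g : H) (x : F) :
    an f (adjoint (an g) x) = ⟪f, g⟫_ℂ • x - adjoint (an g) (an f x) := by
  have := congrArg (fun T : F →L[ℂ] F => T x) (hCAR.2 f g)
  simp only [ContinuousLinearMap.add_apply, ContinuousLinearMap.comp_apply,
    ContinuousLinearMap.smul_apply, ContinuousLinearMap.one_apply] at this
  exact eq_sub_of_add_eq this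

theorem car_norm (hCAR : SatisfiesCAR an) (f : H) (hf : ‖f‖ = 1) (x : F) :
    ‖an f x‖ ≤ ‖x‖ ∧ ‖adjoint (an f) x‖ ≤ ‖x‖ := by
  have h1 : ⟪x, an f (adjoint (an f) x)⟫_ℂ + ⟪x, adjoint (an f) (an f x)⟫_ℂ = ⟪x, x⟫_ℂ := by
    rw [← inner_add_right, car_ac hCAR, inner_self_eq_norm_sq_to_K, hf]; simp
  rw [← ContinuousLinearMap.adjoint_inner_left (an f) (adjoint (an f) x) x,
    ContinuousLinearMap.adjoint_inner_right (an f) x (an f x)] at h1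
  simp only [inner_self_eq_norm_sq_to_K] at h1
  have h2 : ‖adjoint (an f) x‖ ^ 2 + ‖an f x‖ ^ 2 = ‖x‖ ^ 2 := by exact_mod_cast h1
  constructor <;> refine le_of_sq_le_sq ?_ (norm_nonneg _) <;> nlinarith [sq_nonneg ‖adjoint (an f) x‖, sq_nonneg ‖an f x‖]

theorem aux_pair_s10 (hCAR : SatisfiesCAR an) (u v : ℕ → H) (lam : ℕ → ℝ)
    (huv : Orthonormal ℂ (Sum.elim u v)) (hs : Summable fun k => lam k ^ 2) (ψ χ : F)
    (h : ∀ k, an (u k) ψ = (lam k : ℂ) • adjoint (an (v k)) χ) :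
    Summable fun k => (lam k : ℂ) • adjoint (an (u k)) (adjoint (an (v k)) ψ) := by
  have hu : ∀ k, ‖u k‖ = 1 := fun k => huv.1 (Sum.inl k)
  have hv : ∀ k, ‖v k‖ = 1 := fun k => huv.1 (Sum.inr k)
  have huu : ∀ k l, k ≠ l → ⟪u k, u l⟫_ℂ = 0 := fun k l hkl =>
    huv.2 (i := Sum.inl k) (j := Sum.inl l) (by simpa using hkl)
  have hvv : ∀ k l, k ≠ l → ⟪v k, v l⟫_ℂ = 0 := fun k l hkl =>
    huv.2 (i := Sum.inr k) (j := Sum.inr l) (by simpa using hkl)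
  have huv' : ∀ k l, ⟪u k, v l⟫_ℂ = 0 := fun k l =>
    huv.2 (i := Sum.inl k) (j := Sum.inr l) (by simp)
  have hvu' : ∀ k l, ⟪v k, u l⟫_ℂ = 0 := fun k l =>
    huv.2 (i := Sum.inr k) (j := Sum.inl l) (by simp)
  have hb : ∀ k, ‖an (v k) (an (u k) ψ)‖ ≤ |lam k| * ‖χ‖ := fun k => by
    rw [h k, map_smul, norm_smul, Complex.norm_real, Real.norm_eq_abs]
    exact mul_le_mul_of_nonneg_left (((car_norm hCAR _ (hv k) _).1).trans
      (car_norm hCAR _ (hv k) _).2) (abs_nonneg _)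
  have hbd : ∀ k, ‖adjoint (an (u k)) (adjoint (an (v k)) ψ)‖ ≤ ‖ψ‖ := fun k =>
    ((car_norm hCAR _ (hu k) _).2).trans (car_norm hCAR _ (hv k) _).2
  refine aux_summable _ (fun k => lam k ^ 2) (fun k => sq_nonneg _) hs (‖χ‖ ^ 2) (‖ψ‖ ^ 2)
    (by positivity) (by positivity) ?_ ?_
  · intro k l hkl
    rw [inner_smul_left, inner_smul_right]
    have e : ⟪adjoint (an (u k)) (adjoint (an (v k)) ψ),
        adjoint (an (u l)) (adjoint (an (v l)) ψ)⟫_ℂ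
        = ⟪an (v l) (an (u l) ψ), an (v k) (an (u k) ψ)⟫_ℂ := by
      rw [ContinuousLinearMap.adjoint_inner_left, ContinuousLinearMap.adjoint_inner_left,
        ← ContinuousLinearMap.adjoint_inner_right, ← ContinuousLinearMap.adjoint_inner_right]
      congr 1
      rw [car_ac hCAR (u k) (u l), huu k l hkl, car_ac hCAR (u k) (v l), huv' k l]
      simp only [zero_smul, zero_sub, map_neg, neg_neg]
      rw [car_ac hCAR (v k) (u l), hvu', car_ac hCAR (v k) (v l), hvv k l hkl]
      simp
    rw [e, norm_mul, norm_mul]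
    have h1 := (norm_inner_le_norm (𝕜 := ℂ) (an (v l) (an (u l) ψ)) (an (v k) (an (u k) ψ))).trans
      (mul_le_mul (hb l) (hb k) (norm_nonneg _) (by positivity))
    rw [RCLike.norm_conj, Complex.norm_real, Complex.norm_real, Real.norm_eq_abs,
      Real.norm_eq_abs]
    calc _ ≤ |lam k| * (|lam l| * (|lam l| * ‖χ‖ * (|lam k| * ‖χ‖))) := by gcongr
      _ = ‖χ‖ ^ 2 * (|lam k| ^ 2 * |lam l| ^ 2) := by ring
      _ = _ := by rw [sq_abs, sq_abs]
  · intro k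
    rw [inner_self_eq_norm_sq_to_K, norm_smul, Complex.norm_real, Real.norm_eq_abs]
    simp only [norm_pow, Complex.coe_algebraMap, Complex.norm_real, norm_mul, norm_norm,
      Real.norm_eq_abs, abs_abs, mul_pow, sq_abs, abs_norm]
    rw [mul_comm]
    have := hbd k
    gcongr

theorem aux_main (hCAR : SatisfiesCAR an) (u v : ℕ → H) (lam : ℕ → ℝ)
    (huv : Orthonormal ℂ (Sum.elim u v)) (hs : Summable fun k => lam k ^ 2)
    (Ω : F) (hΩ : IsVacuum an Ω) (M : ℕ) :
    ∃ χ : F, (M ≠ 0 → χ = (M : ℂ) • PsiM an u v lam Ω (M - 1)) ∧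
      (∀ k, an (u k) (PsiM an u v lam Ω M) = (lam k : ℂ) • adjoint (an (v k)) χ) ∧
      (∀ k, an (v k) (PsiM an u v lam Ω M) = -((lam k : ℂ) • adjoint (an (u k)) χ)) ∧
      HasSum (fun k => (lam k : ℂ) • adjoint (an (u k)) (adjoint (an (v k)) χ))
        ((M : ℂ) • PsiM an u v lam Ω M) := by
  have huu : ∀ k l, k ≠ l → ⟪u k, u l⟫_ℂ = 0 := fun k l hkl =>
    huv.2 (i := Sum.inl k) (j := Sum.inl l) (by simpa using hkl)
  have hvv : ∀ k l, k ≠ l → ⟪v k, v l⟫_ℂ = 0 := fun k l hkl =>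
    huv.2 (i := Sum.inr k) (j := Sum.inr l) (by simpa using hkl)
  have huv' : ∀ k l, ⟪u k, v l⟫_ℂ = 0 := fun k l =>
    huv.2 (i := Sum.inl k) (j := Sum.inr l) (by simp)
  have hvu' : ∀ k l, ⟪v k, u l⟫_ℂ = 0 := fun k l =>
    huv.2 (i := Sum.inr k) (j := Sum.inl l) (by simp)
  have hu1 : ∀ k, ⟪u k, u k⟫_ℂ = 1 := fun k => by
    rw [inner_self_eq_norm_sq_to_K, show ‖u k‖ = 1 from huv.1 (Sum.inl k)]; simp
  have hv1 : ∀ k, ⟪v k, v k⟫_ℂ = 1 := fun k => by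
    rw [inner_self_eq_norm_sq_to_K, show ‖v k‖ = 1 from huv.1 (Sum.inr k)]; simp
  induction M with
  | zero => exact ⟨0, by simp, by simp [PsiM, hΩ.2], by simp [PsiM, hΩ.2], by simp [hasSum_zero]⟩
  | succ M ih =>
    obtain ⟨χ, -, h1, h2, h3⟩ := ih
    set ψ := PsiM an u v lam Ω M with hψ
    have hS : HasSum (fun k => (lam k : ℂ) • adjoint (an (u k)) (adjoint (an (v k)) ψ))
        (PsiM an u v lam Ω (M + 1)) := (aux_pair_s10 hCAR u v lam huv hs ψ χ h1).hasSum
    refine ⟨((M + 1 : ℕ) : ℂ) • ψ, by simp [hψ], fun k => ?_, fun k => ?_, ?_⟩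
    · have a1 := (an (u k)).hasSum hS
      have a2 := (((adjoint (an (v k))).hasSum h3).const_smul (lam k : ℂ)).add
        (hasSum_ite_eq k ((lam k : ℂ) • adjoint (an (v k)) ψ))
      have e : (lam k : ℂ) • adjoint (an (v k)) (((M + 1 : ℕ) : ℂ) • ψ) =
          (lam k : ℂ) • adjoint (an (v k)) ((M : ℂ) • ψ) + (lam k : ℂ) • adjoint (an (v k)) ψ := by
        rw [← smul_add, ← map_add]; congr 2; push_cast; rw [add_smul, one_smul]
      rw [e]
      refine a1.unique (hasSum_pt a2 ?_)
      intro l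
      simp only [map_smul]
      rw [car_ac hCAR (u k) (u l), car_ac hCAR (u k) (v l), huv', h1 k]
      simp only [map_smul, zero_smul, zero_sub, map_neg, sub_neg_eq_add, smul_add]
      rw [car_cc hCAR (v l) (v k), map_neg, car_cc hCAR (u l) (v k), neg_neg]
      rw [add_comm, smul_comm (lam l : ℂ) (lam k : ℂ)]
      congr 1
      by_cases hkl : l = k
      · subst hkl; rw [hu1]; simp
      · simp [hkl, huu k l (Ne.symm hkl)]
    · have a1 := (an (v k)).hasSum hS
      have a2 := ((((adjoint (an (u k))).hasSum h3).const_smul (lam k : ℂ)).add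
        (hasSum_ite_eq k ((lam k : ℂ) • adjoint (an (u k)) ψ))).neg
      have e : (lam k : ℂ) • adjoint (an (u k)) (((M + 1 : ℕ) : ℂ) • ψ) =
          (lam k : ℂ) • adjoint (an (u k)) ((M : ℂ) • ψ) + (lam k : ℂ) • adjoint (an (u k)) ψ := by
        rw [← smul_add, ← map_add]; congr 2; push_cast; rw [add_smul, one_smul]
      rw [e]
      refine a1.unique (hasSum_pt a2 ?_)
      intro l
      simp only [map_smul]
      rw [car_ac hCAR (v k) (u l), car_ac hCAR (v k) (v l), hvu', h2 k]
      simp only [map_smul, zero_smul, zero_sub, map_neg, map_add, sub_neg_eq_add, smul_neg]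
      rw [car_cc hCAR (v l) (u k)]
      simp only [map_neg, map_add, map_smul, smul_neg]
      rw [car_cc hCAR (u l) (u k)]
      by_cases hkl : l = k
      · subst hkl; rw [hv1]; simp only [one_smul, if_true, smul_neg, neg_neg, smul_add]; abel
      · simp [hkl, hvv k l (Ne.symm hkl)]; exact smul_comm _ _ _
    · have := hS.const_smul ((M + 1 : ℕ) : ℂ)
      refine hasSum_pt this fun k => ?_
      simp only [map_smul]
      rw [smul_comm]

end CARlemmas

/-- **Equation (12).** For every `M` and `k`:
`(λₖ c*_{k,↑} + (M+1)⁻¹ c_{k,↓} B*) Ψ_M = 0` and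
`(λₖ c*_{k,↓} - (M+1)⁻¹ c_{k,↑} B*) Ψ_M = 0`. -/
theorem PsiM_kernel_equation
    {H F T : Type*} [NormedAddCommGroup H] [InnerProductSpace ℂ H] [CompleteSpace H]
    [NormedAddCommGroup F] [InnerProductSpace ℂ F] [CompleteSpace F]
    [NormedAddCommGroup T] [InnerProductSpace ℂ T] [CompleteSpace T]
    (an : H → F →L[ℂ] F) (hCAR : SatisfiesCAR an)
    (tp : H →ₗ[ℂ] H →ₗ[ℂ] T) (htp : IsHilbertTensorProduct tp)
    (u v : ℕ → H) (lam : ℕ → ℝ) (Φ : T) (hΦnorm : ‖Φ‖ = 1)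
    (hΦ : CanonicalWedgeForm tp u v lam Φ)
    (Ω : F) (hΩ : IsVacuum an Ω) :
    ∀ (M k : ℕ),
      (lam k : ℂ) • adjoint (an (u k)) (PsiM an u v lam Ω M)
          + (((((M : ℝ) + 1)⁻¹ : ℝ)) : ℂ) •
            an (v k) (applyBd an u v lam (PsiM an u v lam Ω M)) = 0 ∧
        (lam k : ℂ) • adjoint (an (v k)) (PsiM an u v lam Ω M)
          - (((((M : ℝ) + 1)⁻¹ : ℝ)) : ℂ) •
            an (u k) (applyBd an u v lam (PsiM an u v lam Ω M)) = 0 := by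
  intro M k
  obtain ⟨huv, -, -, hsum, -⟩ := hΦ
  have hs : Summable fun k => lam k ^ 2 := by
    by_contra hns
    rw [tsum_eq_zero_of_not_summable hns] at hsum
    exact zero_ne_one hsum
  obtain ⟨χ, h0, h1, h2, -⟩ := aux_main hCAR u v lam huv hs Ω hΩ (M + 1)
  have h0 := h0 (by omega)
  have hM : ((((M : ℝ) + 1)⁻¹ : ℝ) : ℂ) * ((M + 1 : ℕ) : ℂ) = 1 := by
    have : (M : ℂ) + 1 ≠ 0 := by exact_mod_cast Nat.succ_ne_zero M
    push_cast
    exact inv_mul_cancel₀ this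
  have g1 := h1 k
  have g2 := h2 k
  rw [h0, Nat.add_sub_cancel] at g1 g2
  change an (u k) (applyBd an u v lam (PsiM an u v lam Ω M)) = _ at g1
  change an (v k) (applyBd an u v lam (PsiM an u v lam Ω M)) = _ at g2
  rw [g1, g2]
  simp only [map_smul, smul_neg, smul_comm (lam k : ℂ) ((M + 1 : ℕ) : ℂ)]
  simp only [smul_smul, ← mul_assoc, hM, one_mul]
  exact ⟨add_neg_cancel _, sub_self _⟩
end
end

section
/- Let N ≥ 2, let Ψ ∈ ⋀^N h be normalized, and let Φ ∈ h∧h be normalized with canonical form Φ = Σ_{k=1}^∞ λ_k u_k ∧ v_k. Then ⟨Φ, γ₂^Ψ Φ⟩ ≤ N − ((N−2)/2)·Σ_{k=1}^∞ λ_k²·(‖c(u_k)Ψ‖² + ‖c(v_k)Ψ‖²). -/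
/- Setting: `H` is the one-particle Hilbert space `h`, `F` is the fermionic Fock space over
`h` (carrying annihilation operators `an f = c(f)` satisfying the CAR, with adjoints the
creation operators `c*(f)`, and vacuum `Ω`), and `T` is the two-particle space `h ⊗ h`
(realized by a bilinear map `tp`, with the antisymmetric tensors `h ∧ h` inside it). -/

open scoped ComplexOrder

open ContinuousLinearMap

noncomputable section

theorem aux_pair_s16 {I R : Type*} [DecidableEq I] [Ring R] [StarRing R] [Algebra ℂ R] [StarModule ℂ R]
    (a : I → R) (bar : I ≃ I) (hbar : ∀ f, bar (bar f) = f) (c : I → ℝ)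
    (h1 : ∀ f g, a f * a g = - (a g * a f))
    (h2 : ∀ f g, a f * star (a g) = (if f = g then 1 else 0) - star (a g) * a f) (f g : I) :
    star ((c f : ℂ) • (star (a f) * a g) - (c g : ℂ) • (star (a (bar g)) * a (bar f))) *
      ((c f : ℂ) • (star (a f) * a g) - (c g : ℂ) • (star (a (bar g)) * a (bar f))) =
    ((c f : ℂ)^2) • (star (a g) * a g - (star (a f) * a f) * (star (a g) * a g)
        + (if f = g then star (a g) * a g else 0)) +
    ((c g : ℂ)^2) • (star (a (bar f)) * a (bar f)
        - (star (a (bar g)) * a (bar g)) * (star (a (bar f)) * a (bar f))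
        + (if f = g then star (a (bar f)) * a (bar f) else 0)) -
    ((c f : ℂ) * c g) • ((if f = bar g then star (a g) * a g else 0)
        + (if f = bar g then star (a g) * a g else 0)
        - (star (a g) * star (a (bar g))) * (a f * a (bar f))
        - (star (a (bar f)) * star (a f)) * (a (bar g) * a g)) := by
  have k1 : ∀ f g, star (a g) * a f * (star (a f) * a g) =
      star (a g) * a g - (star (a f) * a f) * (star (a g) * a g)
        + (if f = g then star (a g) * a g else 0) := by
    intro f g
    have e1 : star (a g) * a f * (star (a f) * a g) = star (a g) * (a f * star (a f)) * a g := by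
      noncomm_ring
    have e3 : star (a g) * star (a f) = - (star (a f) * star (a g)) := by
      rw [← star_mul, h1, star_neg, star_mul]
    have e4 : star (a f) * (star (a g) * a f) * a g
        = star (a f) * ((if f = g then 1 else 0) - a f * star (a g)) * a g := by
      rw [h2]; noncomm_ring
    rw [e1, h2 f f]
    simp only [if_true]
    have e5 : star (a g) * (1 - star (a f) * a f) * a g
        = star (a g) * a g - (star (a g) * star (a f)) * a f * a g := by noncomm_ring
    have e6 : (-(star (a f) * star (a g))) * a f * a g = - (star (a f) * (star (a g) * a f) * a g) := by
      noncomm_ring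
    rw [e5, e3, e6, e4]
    split_ifs with h
    · subst h; noncomm_ring
    · noncomm_ring
  have k2 : ∀ f g p q : I, star (a g) * a f * (star (a p) * a q) =
      (if f = p then star (a g) * a q else 0) - (star (a g) * star (a p)) * (a f * a q) := by
    intro f g p q
    have e1 : star (a g) * a f * (star (a p) * a q) = star (a g) * (a f * star (a p)) * a q := by
      noncomm_ring
    rw [e1, h2 f p]
    split_ifs <;> noncomm_ring
  have x1 : star (a g) * a f * (star (a (bar g)) * a (bar f)) =
      (if f = bar g then star (a g) * a g else 0)
        - (star (a g) * star (a (bar g))) * (a f * a (bar f)) := by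
    rw [k2]
    split_ifs with h
    · subst h; rw [hbar]
    · rfl
  have x2 : star (a (bar f)) * a (bar g) * (star (a f) * a g) =
      (if f = bar g then star (a g) * a g else 0)
        - (star (a (bar f)) * star (a f)) * (a (bar g) * a g) := by
    rw [k2]
    by_cases h : f = bar g
    · subst h; simp [hbar]
    · rw [if_neg h, if_neg (fun h' => h h'.symm)]
  have y2 := k1 (bar g) (bar f)
  have y1 := k1 f g
  have hif : (if bar g = bar f then star (a (bar f)) * a (bar f) else 0) =
    (if f = g then star (a (bar f)) * a (bar f) else 0) := by
    by_cases h : f = g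
    · subst h; simp
    · rw [if_neg h, if_neg (fun h' => h (bar.injective h').symm)]
  rw [hif] at y2
  rw [← y1, ← y2]
  have z : star ((c f : ℂ) • (star (a f) * a g) - (c g : ℂ) • (star (a (bar g)) * a (bar f)))
    = (c f : ℂ) • (star (a g) * a f) - (c g : ℂ) • (star (a (bar f)) * a (bar g)) := by
    simp
  rw [z]
  have w : (if f = bar g then star (a g) * a g else 0)
        + (if f = bar g then star (a g) * a g else 0)
        - (star (a g) * star (a (bar g))) * (a f * a (bar f))
        - (star (a (bar f)) * star (a f)) * (a (bar g) * a g) =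
      star (a g) * a f * (star (a (bar g)) * a (bar f)) +
      star (a (bar f)) * a (bar g) * (star (a f) * a g) := by
    rw [x1, x2]; abel
  rw [w]
  simp only [sub_mul, mul_sub, smul_mul_smul_comm, smul_add, sq]
  rw [mul_comm (c g : ℂ) (c f)]
  abel

theorem aux_sum {I R : Type*} [Fintype I] [DecidableEq I] [Ring R] [StarRing R] [Algebra ℂ R]
    [StarModule ℂ R]
    (a : I → R) (bar : I ≃ I) (hbar : ∀ f, bar (bar f) = f) (c : I → ℝ)
    (hc : ∀ f, c (bar f) = - c f)
    (h1 : ∀ f g, a f * a g = - (a g * a f))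
    (h2 : ∀ f g, a f * star (a g) = (if f = g then 1 else 0) - star (a g) * a f) :
    ∑ f, ∑ g, star ((c f : ℂ) • (star (a f) * a g) - (c g : ℂ) • (star (a (bar g)) * a (bar f))) *
      ((c f : ℂ) • (star (a f) * a g) - (c g : ℂ) • (star (a (bar g)) * a (bar f))) =
    (2 : ℂ) • ((∑ f, (c f : ℂ)^2) • (∑ g, star (a g) * a g)
      - (∑ f, (c f : ℂ)^2 • (star (a f) * a f)) * (∑ g, star (a g) * a g)
      + (2 : ℂ) • (∑ f, (c f : ℂ)^2 • (star (a f) * a f))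
      - star (∑ f, (c f : ℂ) • (a (bar f) * a f)) * (∑ f, (c f : ℂ) • (a (bar f) * a f))) := by
  have hc2 : ∀ f, (c f : ℂ)^2 = (c (bar f) : ℂ)^2 := by intro f; rw [hc]; push_cast; ring
  set N := ∑ g, star (a g) * a g with hN
  set A := ∑ f, (c f : ℂ)^2 • (star (a f) * a f) with hA
  set C := ∑ f, (c f : ℂ) • (a (bar f) * a f) with hC
  have s1 : ∑ f, ∑ g, ((c f : ℂ)^2) • (star (a g) * a g - (star (a f) * a f) * (star (a g) * a g)
        + (if f = g then star (a g) * a g else 0)) = (∑ f, (c f : ℂ)^2) • N - A * N + A := by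
    simp only [smul_add, smul_sub, Finset.sum_add_distrib, Finset.sum_sub_distrib]
    congr 1
    · congr 1
      · simp only [← Finset.smul_sum, ← hN, Finset.sum_smul]
      · rw [hA, hN, Finset.sum_mul_sum]
        simp only [smul_mul_assoc]
    · simp [hA]
  have s2 : ∑ f, ∑ g, ((c g : ℂ)^2) • (star (a (bar f)) * a (bar f)
        - (star (a (bar g)) * a (bar g)) * (star (a (bar f)) * a (bar f))
        + (if f = g then star (a (bar f)) * a (bar f) else 0)) =
        (∑ f, (c f : ℂ)^2) • N - A * N + A := by
    rw [← s1, Finset.sum_comm, ← Equiv.sum_comp bar]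
    refine Finset.sum_congr rfl fun f _ => ?_
    rw [← Equiv.sum_comp bar]
    refine Finset.sum_congr rfl fun g _ => ?_
    rw [hbar, hbar, ← hc2]
    have : (bar g = bar f) = (f = g) := by
      rw [bar.injective.eq_iff]; exact propext eq_comm
    simp only [this]
  have hC' : ∑ f, (c f : ℂ) • (a f * a (bar f)) = - C := by
    rw [hC, ← Finset.sum_neg_distrib]
    exact Finset.sum_congr rfl fun f _ => by rw [h1, smul_neg]
  have hCs : ∑ f, (c f : ℂ) • (star (a (bar f)) * star (a f)) = - star C := by
    rw [← star_neg, ← hC', star_sum]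
    simp
  have hCs' : ∑ f, (c f : ℂ) • (star (a f) * star (a (bar f))) = star C := by
    rw [hC, star_sum]
    simp
  have s3 : ∑ f, ∑ g, ((c f : ℂ) * c g) • ((if f = bar g then star (a g) * a g else 0)
        + (if f = bar g then star (a g) * a g else 0)
        - (star (a g) * star (a (bar g))) * (a f * a (bar f))
        - (star (a (bar f)) * star (a f)) * (a (bar g) * a g)) =
       - A - A + star C * C + star C * C := by
    rw [Finset.sum_comm]
    simp only [smul_add, smul_sub, Finset.sum_add_distrib, Finset.sum_sub_distrib]
    have t1 : ∑ g, ∑ f, ((c f : ℂ) * c g) • (if f = bar g then star (a g) * a g else 0) = -A := by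
      simp [hA, hc, sq, neg_smul]
    have t2 : ∑ g, ∑ f, ((c f : ℂ) * c g) • ((star (a g) * star (a (bar g))) * (a f * a (bar f)))
        = star C * (-C) := by
      rw [← hCs', ← hC', Finset.sum_mul_sum]
      simp only [smul_mul_smul_comm, mul_comm]
    have t3 : ∑ g, ∑ f, ((c f : ℂ) * c g) • ((star (a (bar f)) * star (a f)) * (a (bar g) * a g))
        = -star C * C := by
      rw [Finset.sum_comm, ← hCs, hC, Finset.sum_mul_sum]
      simp only [smul_mul_smul_comm]
    rw [t1, t2, t3]
    noncomm_ring
  simp only [aux_pair_s16 a bar hbar c h1 h2, Finset.sum_add_distrib, Finset.sum_sub_distrib] at *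
  rw [s1, s2, s3]
  simp only [two_smul]
  abel

theorem aux_inner {F : Type*} [NormedAddCommGroup F] [InnerProductSpace ℂ F] (x : F) :
    ⟪x, x⟫_ℂ = ((‖x‖ ^ 2 : ℝ) : ℂ) := by
  rw [inner_self_eq_norm_sq_to_K]; push_cast; rfl

theorem aux_nonneg {I F : Type*} [Fintype I] [DecidableEq I]
    [NormedAddCommGroup F] [InnerProductSpace ℂ F] [CompleteSpace F]
    (a : I → F →L[ℂ] F) (bar : I ≃ I) (hbar : ∀ f, bar (bar f) = f) (c : I → ℝ)
    (hc : ∀ f, c (bar f) = - c f)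
    (h1 : ∀ f g, a f * a g = - (a g * a f))
    (h2 : ∀ f g, a f * star (a g) = (if f = g then 1 else 0) - star (a g) * a f) (Ψ : F) :
    ‖∑ f, (c f : ℂ) • (a (bar f) (a f Ψ))‖ ^ 2 ≤
      (∑ f, c f ^ 2) * (⟪Ψ, ∑ g, adjoint (a g) (a g Ψ)⟫_ℂ).re
      - (⟪∑ f, (c f : ℂ)^2 • adjoint (a f) (a f Ψ), ∑ g, adjoint (a g) (a g Ψ)⟫_ℂ).re
      + 2 * (⟪Ψ, ∑ f, (c f : ℂ)^2 • adjoint (a f) (a f Ψ)⟫_ℂ).re := by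
  have key := aux_sum a bar hbar c hc h1 h2
  set N := ∑ g, star (a g) * a g with hN
  set A := ∑ f, (c f : ℂ)^2 • (star (a f) * a f) with hA
  set C := ∑ f, (c f : ℂ) • (a (bar f) * a f) with hC
  have eN : ∑ g, adjoint (a g) (a g Ψ) = N Ψ := by
    simp [hN, star_eq_adjoint]
  have eA : ∑ f, (c f : ℂ)^2 • adjoint (a f) (a f Ψ) = A Ψ := by
    simp [hA, star_eq_adjoint]
  have eC : ∑ f, (c f : ℂ) • (a (bar f) (a f Ψ)) = C Ψ := by
    simp [hC]
  have hAs : adjoint A = A := by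
    rw [← star_eq_adjoint, hA, star_sum]
    simp
  rw [eN, eA, eC]
  have pos : ∀ T : F →L[ℂ] F, 0 ≤ (⟪Ψ, (star T * T) Ψ⟫_ℂ).re := by
    intro T
    rw [star_eq_adjoint, mul_apply_eq_comp, adjoint_inner_right,
      aux_inner, Complex.ofReal_re]
    positivity
  have e : (⟪Ψ, (star C * C) Ψ⟫_ℂ).re = ‖C Ψ‖ ^ 2 := by
    rw [star_eq_adjoint, mul_apply_eq_comp, adjoint_inner_right,
      aux_inner, Complex.ofReal_re]
  have e2 : ⟪A Ψ, N Ψ⟫_ℂ = ⟪Ψ, (A * N) Ψ⟫_ℂ := by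
    rw [mul_apply_eq_comp, ← adjoint_inner_left A, hAs]
  have key2 := congrArg (fun X : F →L[ℂ] F => (⟪Ψ, X Ψ⟫_ℂ).re) key
  simp only [_root_.sum_apply, inner_sum, Complex.re_sum] at key2
  have h0 := (Finset.sum_nonneg fun f (_ : f ∈ Finset.univ) => Finset.sum_nonneg
    fun g (_ : g ∈ Finset.univ) => pos ((c f : ℂ) • (star (a f) * a g)
      - (c g : ℂ) • (star (a (bar g)) * a (bar f))))
  rw [key2] at h0
  simp only [_root_.smul_apply, _root_.sub_apply,
    _root_.add_apply, inner_smul_right, inner_sub_right, inner_add_right] at h0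
  rw [e2, ← e]
  have h3 : (∑ f, (c f : ℂ)^2) = ((∑ f, c f ^ 2 : ℝ) : ℂ) := by push_cast; rfl
  rw [h3] at h0
  have h4 : (2 : ℂ) = ((2 : ℝ) : ℂ) := by norm_num
  rw [h4] at h0
  simp only [Complex.re_ofReal_mul, Complex.sub_re, Complex.add_re] at h0
  linarith

theorem aux_fin {H F : Type*} [NormedAddCommGroup H] [InnerProductSpace ℂ H]
    [NormedAddCommGroup F] [InnerProductSpace ℂ F] [CompleteSpace F]
    (an : H → F →L[ℂ] F) (hCAR : SatisfiesCAR an) (u v : ℕ → H) (lam : ℕ → ℝ)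
    (ho : Orthonormal ℂ (Sum.elim u v)) (Ψ : F) (s : Finset ℕ) :
    ‖∑ k ∈ s, (lam k : ℂ) • (an (v k) (an (u k) Ψ) - an (u k) (an (v k) Ψ))‖ ^ 2 ≤
      (2 * ∑ k ∈ s, lam k ^ 2) *
        (⟪Ψ, ∑ k ∈ s, (adjoint (an (u k)) (an (u k) Ψ) + adjoint (an (v k)) (an (v k) Ψ))⟫_ℂ).re
      - (⟪∑ k ∈ s, (lam k : ℂ)^2 • (adjoint (an (u k)) (an (u k) Ψ)
            + adjoint (an (v k)) (an (v k) Ψ)),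
          ∑ k ∈ s, (adjoint (an (u k)) (an (u k) Ψ) + adjoint (an (v k)) (an (v k) Ψ))⟫_ℂ).re
      + 2 * (⟪Ψ, ∑ k ∈ s, (lam k : ℂ)^2 • (adjoint (an (u k)) (an (u k) Ψ)
            + adjoint (an (v k)) (an (v k) Ψ))⟫_ℂ).re := by
  obtain ⟨c1, c2⟩ := hCAR
  let i : (s ⊕ s) → (ℕ ⊕ ℕ) := Sum.map Subtype.val Subtype.val
  have hi : Function.Injective i :=
    Function.Injective.sumMap Subtype.val_injective Subtype.val_injective
  have key := aux_nonneg (I := s ⊕ s) (fun f => an (Sum.elim u v (i f))) (Equiv.sumComm s s)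
    (fun f => by cases f <;> rfl)
    (Sum.elim (fun k => lam k) (fun k => - lam k)) (fun f => by cases f <;> simp)
    (fun f g => eq_neg_of_add_eq_zero_left (c1 _ _))
    (fun f g => by
      have := c2 (Sum.elim u v (i f)) (Sum.elim u v (i g))
      rw [orthonormal_iff_ite.1 ho] at this
      simp only [hi.eq_iff] at this
      rw [eq_sub_iff_add_eq, star_eq_adjoint]
      refine Eq.trans this ?_
      split_ifs <;> simp) Ψ
  simp only [Fintype.sum_sum_type, i, Sum.map_inl, Sum.map_inr, Sum.elim_inl, Sum.elim_inr,
    Equiv.sumComm_apply, Sum.swap_inl, Sum.swap_inr, Complex.ofReal_neg, neg_sq] at key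
  simp only [← Finset.sum_add_distrib, ← smul_add, ← two_mul, neg_smul, ← sub_eq_add_neg,
    ← smul_sub] at key
  rw [Finset.sum_coe_sort s (fun k => lam k ^ 2),
    Finset.sum_coe_sort s (fun k => (lam k : ℂ) • (an (v k) (an (u k) Ψ) - an (u k) (an (v k) Ψ))),
    Finset.sum_coe_sort s (fun k => (adjoint (an (u k)) (an (u k) Ψ) + adjoint (an (v k)) (an (v k) Ψ))),
    Finset.sum_coe_sort s (fun k => (lam k : ℂ)^2 • (adjoint (an (u k)) (an (u k) Ψ)
            + adjoint (an (v k)) (an (v k) Ψ)))] at key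
  exact key

theorem aux_G {H F T : Type*} [NormedAddCommGroup H] [InnerProductSpace ℂ H]
    [NormedAddCommGroup F] [InnerProductSpace ℂ F] [CompleteSpace F]
    [NormedAddCommGroup T] [InnerProductSpace ℂ T]
    (an : H → F →L[ℂ] F) (tp : H →ₗ[ℂ] H →ₗ[ℂ] T) (u v : ℕ → H) (lam : ℕ → ℝ) (Ψ : F)
    (G : T →L[ℂ] T) (hG : IsTwoBodyOp tp an Ψ G) (s : Finset ℕ) :
    ⟪∑ k ∈ s, (lam k : ℂ) • wedgeVec tp (u k) (v k),
      G (∑ k ∈ s, (lam k : ℂ) • wedgeVec tp (u k) (v k))⟫_ℂ =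
    ((‖∑ k ∈ s, (lam k : ℂ) • (an (v k) (an (u k) Ψ) - an (u k) (an (v k) Ψ))‖ ^ 2 / 2 : ℝ) : ℂ) := by
  have hh : ∀ p q r s : H, ⟪tp p q, G (tp r s)⟫_ℂ = ⟪an s (an r Ψ), an q (an p Ψ)⟫_ℂ := by
    intro p q r s
    rw [hG, adjoint_inner_right, adjoint_inner_right]
  have h2 : (((Real.sqrt 2 : ℝ) : ℂ))⁻¹ * (((Real.sqrt 2 : ℝ) : ℂ))⁻¹ = 1 / 2 := by
    rw [← mul_inv, ← Complex.ofReal_mul, Real.mul_self_sqrt (by norm_num)]; norm_num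
  have hw : ∀ j k, ⟪wedgeVec tp (u j) (v j), G (wedgeVec tp (u k) (v k))⟫_ℂ =
      1 / 2 * ⟪an (v k) (an (u k) Ψ) - an (u k) (an (v k) Ψ),
        an (v j) (an (u j) Ψ) - an (u j) (an (v j) Ψ)⟫_ℂ := by
    intro j k
    simp only [wedgeVec, map_smul, map_sub, inner_smul_left, inner_smul_right, inner_sub_left,
      inner_sub_right, hh, map_inv₀, Complex.conj_ofReal]
    rw [← h2]; ring
  have : ((‖∑ k ∈ s, (lam k : ℂ) • (an (v k) (an (u k) Ψ) - an (u k) (an (v k) Ψ))‖ ^ 2 / 2 : ℝ) : ℂ)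
    = 1 / 2 * ⟪∑ k ∈ s, (lam k : ℂ) • (an (v k) (an (u k) Ψ) - an (u k) (an (v k) Ψ)),
      ∑ k ∈ s, (lam k : ℂ) • (an (v k) (an (u k) Ψ) - an (u k) (an (v k) Ψ))⟫_ℂ := by
    rw [aux_inner]; push_cast; ring
  rw [this]
  simp only [map_sum, map_smul, sum_inner, inner_sum, inner_smul_left, inner_smul_right, hw,
    Complex.conj_ofReal, Finset.mul_sum]
  rw [Finset.sum_comm]
  refine Finset.sum_congr rfl fun j _ => Finset.sum_congr rfl fun k _ => ?_
  ring

theorem aux_bdd {H F : Type*} [NormedAddCommGroup H] [InnerProductSpace ℂ H]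
    [NormedAddCommGroup F] [InnerProductSpace ℂ F] [CompleteSpace F]
    (an : H → F →L[ℂ] F) (hCAR : SatisfiesCAR an) (f : H) (hf : ‖f‖ = 1) (x : F) :
    ‖an f x‖ ≤ ‖x‖ ∧ ‖adjoint (an f) x‖ ≤ ‖x‖ := by
  have h := congrArg (fun X : F →L[ℂ] F => (⟪x, X x⟫_ℂ).re) (hCAR.2 f f)
  simp only [_root_.add_apply, comp_apply, inner_add_right, _root_.smul_apply, inner_smul_right,
    one_apply_eq_self] at h
  rw [← adjoint_inner_left (an f) (adjoint (an f) x) x,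
    adjoint_inner_right (an f) x (an f x), aux_inner, aux_inner, aux_inner, aux_inner, hf,
    ← Complex.ofReal_mul, Complex.add_re, Complex.ofReal_re, Complex.ofReal_re,
    Complex.ofReal_re] at h
  constructor
  · refine le_of_sq_le_sq ?_ (norm_nonneg _)
    nlinarith [sq_nonneg ‖adjoint (an f) x‖]
  · refine le_of_sq_le_sq ?_ (norm_nonneg _)
    nlinarith [sq_nonneg ‖an f x‖]

/-- **Equation (26).** For `N ≥ 2` and any normalized `Ψ ∈ ⋀^N h`:
`⟪Φ, γ₂^Ψ Φ⟫ ≤ N - (N-2)/2 · ∑ₖ λₖ²(‖c_{k,↑}Ψ‖² + ‖c_{k,↓}Ψ‖²)`. -/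
theorem gamma2_expectation_upper_bound
    {H F T : Type*} [NormedAddCommGroup H] [InnerProductSpace ℂ H] [CompleteSpace H]
    [NormedAddCommGroup F] [InnerProductSpace ℂ F] [CompleteSpace F]
    [NormedAddCommGroup T] [InnerProductSpace ℂ T] [CompleteSpace T]
    (an : H → F →L[ℂ] F) (hCAR : SatisfiesCAR an)
    (tp : H →ₗ[ℂ] H →ₗ[ℂ] T) (htp : IsHilbertTensorProduct tp)
    (u v : ℕ → H) (lam : ℕ → ℝ) (Φ : T) (hΦnorm : ‖Φ‖ = 1)
    (hΦ : CanonicalWedgeForm tp u v lam Φ)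
    (N : ℕ) (hN : 2 ≤ N)
    (Ψ : F) (hΨnorm : ‖Ψ‖ = 1) (hΨsec : InSector an u v N Ψ)
    (G : T →L[ℂ] T) (hG : IsTwoBodyOp tp an Ψ G) :
    ⟪Φ, G Φ⟫_ℂ ≤
      (((N : ℝ) - ((N : ℝ) - 2) / 2 *
        ∑' k : ℕ, lam k ^ 2 * (‖an (u k) Ψ‖ ^ 2 + ‖an (v k) Ψ‖ ^ 2) : ℝ) : ℂ) := by
  obtain ⟨ho, -, -, hlam, hΦe⟩ := hΦ
  have hsL : Summable (fun k => lam k ^ 2) := by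
    by_contra h
    rw [tsum_eq_zero_of_not_summable h] at hlam
    exact zero_ne_one hlam
  have hL : HasSum (fun k => lam k ^ 2) 1 := hlam ▸ hsL.hasSum
  have hsΦ : HasSum (fun k => (lam k : ℂ) • wedgeVec tp (u k) (v k)) Φ := by
    have : Summable (fun k => (lam k : ℂ) • wedgeVec tp (u k) (v k)) := by
      by_contra h
      rw [tsum_eq_zero_of_not_summable h] at hΦe
      rw [hΦe] at hΦnorm
      simp at hΦnorm
    rw [hΦe]; exact this.hasSum
  have hsN : HasSum (fun k => adjoint (an (u k)) (an (u k) Ψ) + adjoint (an (v k)) (an (v k) Ψ))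
      ((N : ℂ) • Ψ) := by
    have : Summable (fun k => adjoint (an (u k)) (an (u k) Ψ)
        + adjoint (an (v k)) (an (v k) Ψ)) := by
      by_contra h
      have h' := hΨsec
      rw [InSector, tsum_eq_zero_of_not_summable h] at h'
      have h2 := congrArg norm h'
      rw [norm_smul, hΨnorm] at h2
      have h3 : (N : ℝ) = 0 := by simpa using h2.symm
      have h4 : N = 0 := by exact_mod_cast h3
      omega
    have h' : _ = _ := hΨsec
    rw [← h']; exact this.hasSum
  have hu : ∀ k, ‖u k‖ = 1 := fun k => ho.1 (Sum.inl k)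
  have hv : ∀ k, ‖v k‖ = 1 := fun k => ho.1 (Sum.inr k)
  have hsA : Summable (fun k => (lam k : ℂ) ^ 2 • (adjoint (an (u k)) (an (u k) Ψ)
      + adjoint (an (v k)) (an (v k) Ψ))) := by
    refine Summable.of_norm_bounded (g := fun k => lam k ^ 2 * 2) (hsL.mul_right 2) fun k => ?_
    have b1 := ((aux_bdd an hCAR (u k) (hu k) (an (u k) Ψ)).2).trans
      (aux_bdd an hCAR (u k) (hu k) Ψ).1
    have b2 := ((aux_bdd an hCAR (v k) (hv k) (an (v k) Ψ)).2).trans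
      (aux_bdd an hCAR (v k) (hv k) Ψ).1
    rw [hΨnorm] at b1 b2
    rw [norm_smul, norm_pow, Complex.norm_real, Real.norm_eq_abs, sq_abs]
    refine mul_le_mul_of_nonneg_left ?_ (sq_nonneg _)
    exact (norm_add_le _ _).trans (by linarith)
  obtain ⟨A, hA⟩ := hsA
  set S := ∑' k : ℕ, lam k ^ 2 * (‖an (u k) Ψ‖ ^ 2 + ‖an (v k) Ψ‖ ^ 2) with hS
  have hAS : (⟪Ψ, A⟫_ℂ).re = S := by
    have h1 := Complex.hasSum_re ((innerSL ℂ Ψ).hasSum hA)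
    rw [hS, ← innerSL_apply_apply ℂ, ← h1.tsum_eq]
    refine tsum_congr fun k => ?_
    simp only [innerSL_apply_apply, inner_smul_right, inner_add_right, adjoint_inner_right,
      aux_inner]
    norm_cast
  have hAS' : (⟪A, Ψ⟫_ℂ).re = S := by
    rw [← hAS, ← inner_conj_symm, Complex.conj_re]
  have lim1 : Filter.Tendsto (fun s : Finset ℕ =>
      ⟪∑ k ∈ s, (lam k : ℂ) • wedgeVec tp (u k) (v k),
      G (∑ k ∈ s, (lam k : ℂ) • wedgeVec tp (u k) (v k))⟫_ℂ) Filter.atTop (nhds ⟪Φ, G Φ⟫_ℂ) :=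
    Filter.Tendsto.inner hsΦ ((G.continuous.tendsto _).comp hsΦ)
  have lim2 := (((hL.const_mul 2).mul (Complex.continuous_re.tendsto _ |>.comp
    ((tendsto_const_nhds (x := Ψ)).inner hsN))).sub (Complex.continuous_re.tendsto _ |>.comp
      (Filter.Tendsto.inner hA hsN))).add ((Complex.continuous_re.tendsto _ |>.comp
      ((tendsto_const_nhds (x := Ψ)).inner hA)).const_mul 2)
  simp only [aux_G an tp u v lam Ψ G hG] at lim1
  have limre := (Complex.continuous_re.tendsto _).comp lim1
  have limim := (Complex.continuous_im.tendsto _).comp lim1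
  have him : (⟪Φ, G Φ⟫_ℂ).im = 0 := by
    refine tendsto_nhds_unique limim ?_
    refine tendsto_const_nhds.congr fun s => ?_
    simp only [Function.comp, Complex.ofReal_im]
  have hre := le_of_tendsto_of_tendsto (limre.const_mul 2) lim2 (Filter.Eventually.of_forall
    fun s => by
      have := aux_fin an hCAR u v lam ho Ψ s
      simp only [Function.comp, Complex.ofReal_re, ← Finset.mul_sum]
      linarith)
  rw [inner_smul_right, inner_smul_right, aux_inner, hΨnorm, hAS, ← Complex.ofReal_natCast,
    Complex.re_ofReal_mul, Complex.re_ofReal_mul, hAS', Complex.ofReal_re] at hre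
  rw [Complex.le_def, Complex.ofReal_re, Complex.ofReal_im]
  refine ⟨?_, him⟩
  linarith
end
end
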